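/- arXiv:1510.03665 — 5 statements merged into one kernel-verified Lean document; each statement's English description precedes it below -/
import Mathlib

section
/- Let r be an odd prime and n a natural number with n ≥ r. Then the alternating group A_n has abelian (commutative) Sylow r-subgroups if and only if n < r^2. (For n < r this holds trivially since the Sylow r-subgroups are trivial or cyclic; the full statement is: A_n has abelian Sylow r-subgroups if and only if n < r^2.) -/
open MulAction

/-- A subgroup of index `1` or `p` in a finite `p`-group contains the commutator subgroup. -/
theorem IsPGroup.commutator_le_of_index_dvd {p : ℕ} [hp : Fact p.Prime] {G : Type*} [Group G]
    [Finite G] (hG : IsPGroup p G) {H : Subgroup G} (hH : H.index ∣ p) : commutator G ≤ H := by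
  rcases (Nat.dvd_prime hp.out).mp hH with h | h
  · rw [Subgroup.index_eq_one.mp h]
    exact le_top
  · obtain ⟨k, hk⟩ := hG.exists_card_eq
    have hk0 : k ≠ 0 := by
      rintro rfl
      have := H.index_dvd_card
      rw [h, hk, pow_zero, Nat.dvd_one] at this
      exact hp.out.one_lt.ne' this
    have : H.Normal := Subgroup.normal_of_index_eq_minFac_card (by
      rw [h, hk, hp.out.pow_minFac hk0])
    rw [← Subgroup.Normal.quotient_commutative_iff_commutator_le]
    exact (isCyclic_of_prime_card (p := p) h).isMulCommutative

/-- A finite `p`-group acting faithfully on fewer than `p ^ 2` points is abelian. -/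
theorem IsPGroup.isMulCommutative_of_card_lt_sq {p : ℕ} [hp : Fact p.Prime] {G α : Type*}
    [Group G] [Finite G] [Finite α] [MulAction G α] [FaithfulSMul G α] (hG : IsPGroup p G)
    (hα : Nat.card α < p ^ 2) : IsMulCommutative G := by
  rw [isMulCommutative_iff]
  intro a b
  rw [← commutatorElement_eq_one_iff_mul_comm]
  refine FaithfulSMul.eq_of_smul_eq_smul (α := α) fun x ↦ ?_
  rw [one_smul, ← mem_stabilizer_iff]
  refine hG.commutator_le_of_index_dvd ?_
    (Subgroup.commutator_mem_commutator (Subgroup.mem_top a) (Subgroup.mem_top b))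
  obtain ⟨k, hk⟩ := hG.card_orbit x
  have hk2 : k < 2 := by
    rw [← Nat.pow_lt_pow_iff_right hp.out.one_lt, ← hk]
    exact (Nat.card_le_card_of_injective _ Subtype.val_injective).trans_lt hα
  rw [index_stabilizer, ← Nat.card_coe_set_eq, hk]
  exact (pow_dvd_pow p (Nat.le_of_lt_succ hk2)).trans (pow_one p).dvd

/-- The regular wreath product of nontrivial groups is not abelian. -/
theorem RegularWreathProduct.not_isMulCommutative (D Q : Type*) [Group D] [Group Q]
    [Nontrivial D] [Nontrivial Q] : ¬ IsMulCommutative (D ≀ᵣ Q) := by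
  classical
  intro h
  obtain ⟨d, hd⟩ := exists_ne (1 : D)
  obtain ⟨q, hq⟩ := exists_ne (1 : Q)
  have hcomm := congrFun (congrArg left
    (isMulCommutative_iff.mp h ⟨Pi.mulSingle 1 d, 1⟩ (inl q))) 1
  simp [Pi.mulSingle_apply, hq, hd] at hcomm

/-- For odd `p`, the image of a `p`-group under a permutation representation consists of even
permutations. -/
theorem IsPGroup.map_mem_alternatingGroup {p : ℕ} (hodd : Odd p) {G α : Type*} [Group G]
    [Fintype α] [DecidableEq α] (hG : IsPGroup p G) (f : G →* Equiv.Perm α) (g : G) :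
    f g ∈ alternatingGroup α := by
  obtain ⟨k, hk⟩ := hG g
  rw [Equiv.Perm.mem_alternatingGroup]
  have h : Equiv.Perm.sign (f g) ^ p ^ k = 1 := by rw [← map_pow, ← map_pow, hk, map_one, map_one]
  rcases Int.units_eq_one_or (Equiv.Perm.sign (f g)) with h1 | h1
  · exact h1
  · rw [h1, hodd.pow.neg_one_pow] at h
    rw [h1, h]

/-- If the Sylow `p`-subgroups of `G` are abelian, so is every `p`-group embedding in `G`. -/
theorem IsPGroup.isMulCommutative_of_injective {p : ℕ} {G K : Type*} [Group G] [Group K]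
    (h : ∀ P : Sylow p G, IsMulCommutative (P : Subgroup G)) (hK : IsPGroup p K) (f : K →* G)
    (hf : Function.Injective f) : IsMulCommutative K := by
  obtain ⟨P, hP⟩ := (hK.of_equiv (MonoidHom.ofInjective hf)).exists_le_sylow
  have := h P
  rw [isMulCommutative_iff]
  intro a b
  apply hf
  rw [map_mul, map_mul]
  exact setLike_mul_comm (s := (P : Subgroup G)) (hP ⟨a, rfl⟩) (hP ⟨b, rfl⟩)

/-- Let `r` be an odd prime and `n` a natural number. The alternating group `A_n` has
abelian Sylow `r`-subgroups if and only if `n < r ^ 2`. -/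
theorem alternatingGroup_sylow_isCommutative_iff (r n : ℕ) (hr : r.Prime) (hodd : Odd r) :
    (∀ P : Sylow r (alternatingGroup (Fin n)), IsMulCommutative (P : Subgroup (alternatingGroup (Fin n))))
      ↔ n < r ^ 2 := by
  have : Fact r.Prime := ⟨hr⟩
  constructor
  · intro h
    by_contra! hn
    let C := Multiplicative (ZMod r)
    have hC : Nat.card C = r := Nat.card_zmod r
    have hW : IsPGroup r (C ≀ᵣ C) := IsPGroup.of_card (n := r + 1) (by
      rw [RegularWreathProduct.card, hC, pow_succ])
    obtain ⟨e⟩ : Nonempty (C × C ↪ Fin n) := by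
      rw [Function.Embedding.nonempty_iff_card_le, ← Nat.card_eq_fintype_card, Nat.card_prod, hC,
        Fintype.card_fin, ← sq]
      exact hn
    let f : C ≀ᵣ C →* Equiv.Perm (Fin n) :=
      (Equiv.Perm.viaEmbeddingHom e).comp (RegularWreathProduct.toPerm C C C)
    have hf : Function.Injective f :=
      (Equiv.Perm.viaEmbeddingHom_injective e).comp (RegularWreathProduct.toPermInj C C C)
    exact RegularWreathProduct.not_isMulCommutative C C (hW.isMulCommutative_of_injective h
      (f.codRestrict _ (hW.map_mem_alternatingGroup hodd f))
      fun a b hab ↦ hf (congrArg Subtype.val hab))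
  · intro hn P
    have : FaithfulSMul P (Fin n) :=
      ⟨fun h ↦ Subtype.ext (Subtype.ext (Equiv.ext h))⟩
    exact P.isPGroup'.isMulCommutative_of_card_lt_sq (α := Fin n) (by rwa [Nat.card_fin])
end

section
/- Let F be a finite field of cardinality q, let r be an odd prime not dividing q, let m be the multiplicative order of q modulo r, and assume m ≥ 2. Then for every n ≥ 2, the Sylow r-subgroups of the projective special linear group PSL_n(F) are abelian (commutative) if and only if n < m·r. -/
open Matrix

section PSubgroups

variable {G : Type*} [Group G] {r : ℕ}

/-- If an abelian group whose order has the same `r`-part as that of `G` embeds into `G`, then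
all `r`-subgroups of `G` are abelian. -/
theorem IsPGroup.commute_of_injective_of_factorization_eq [Finite G] [Fact r.Prime]
    {A : Type*} [CommGroup A] (f : A →* G) (hf : Function.Injective f)
    (hA : (Nat.card A).factorization r = (Nat.card G).factorization r)
    {H : Subgroup G} (hH : IsPGroup r H) {x y : G} (hx : x ∈ H) (hy : y ∈ H) : Commute x y := by
  have : Finite A := Finite.of_injective f hf
  obtain ⟨S⟩ : Nonempty (Sylow r A) := inferInstance
  have hcard : Nat.card ((S : Subgroup A).map f) = r ^ (Nat.card G).factorization r := by
    rw [Subgroup.card_map_of_injective hf, ← hA, S.card_eq_multiplicity]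
  obtain ⟨Q, hQ⟩ := hH.exists_le_sylow
  obtain ⟨g, hg⟩ := MulAction.exists_smul_eq G (Sylow.ofCard _ hcard) Q
  have key : ∀ z ∈ H, ∃ a : A, z = g * f a * g⁻¹ := by
    intro z hz
    have hzQ : z ∈ (Q : Subgroup G) := hQ hz
    rw [← hg, Sylow.coe_subgroup_smul, Sylow.coe_ofCard,
      Subgroup.mem_smul_pointwise_iff_exists] at hzQ
    obtain ⟨_, ⟨a, -, rfl⟩, rfl⟩ := hzQ
    exact ⟨a, rfl⟩
  obtain ⟨a, rfl⟩ := key x hx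
  obtain ⟨b, rfl⟩ := key y hy
  exact (Commute.conj_iff g).2 ((Commute.all a b).map f)

end PSubgroups

section LinearGroups

variable (F : Type*) [Field F]

/-- The automorphism group of a vector space of dimension at most `n` embeds into `GLₙ`. -/
theorem exists_injective_linearEquiv_hom_GL (W : Type*) [AddCommGroup W] [Module F W]
    [FiniteDimensional F W] {n : ℕ} (hn : Module.finrank F W ≤ n) :
    ∃ f : (W ≃ₗ[F] W) →* GL (Fin n) F, Function.Injective f := by
  let U := Fin (n - Module.finrank F W) → F
  let pad : (W ≃ₗ[F] W) →* ((W × U) ≃ₗ[F] (W × U)) :=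
    { toFun := fun e => e.prodCongr (LinearEquiv.refl F U)
      map_one' := by ext <;> rfl
      map_mul' := fun _ _ => by ext <;> rfl }
  have hpad : Function.Injective pad := fun a b hab => LinearEquiv.ext fun w =>
    congrArg Prod.fst (LinearEquiv.congr_fun hab (w, 0))
  have hdim : Module.finrank F (W × U) = n := by
    simp only [U, Module.finrank_prod, Module.finrank_fin_fun]
    omega
  let e : ((W × U) ≃ₗ[F] (W × U)) ≃* GL (Fin n) F :=
    (LinearMap.GeneralLinearGroup.generalLinearEquiv F (W × U)).symm.trans
      (Matrix.GeneralLinearGroup.toLin' (Module.finBasisOfFinrankEq F (W × U) hdim)).symm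
  exact ⟨e.toMonoidHom.comp pad, e.injective.comp hpad⟩

variable (K : Type*) [Field K] [Algebra F K]

/-- Functions `ι → Kˣ` act on `ι → K` by coordinatewise multiplication. -/
def diagonalHom (ι : Type*) : (ι → Kˣ) →* ((ι → K) ≃ₗ[F] (ι → K)) where
  toFun d := LinearEquiv.piCongrRight fun i => DistribMulAction.toModuleAut F K (d i)
  map_one' := by ext; simp
  map_mul' _ _ := by ext; simp [mul_smul]

theorem diagonalHom_apply {ι : Type*} (d : ι → Kˣ) (f : ι → K) (i : ι) :
    diagonalHom F K ι d f i = d i * f i := rfl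

theorem diagonalHom_injective (ι : Type*) : Function.Injective (diagonalHom F K ι) := by
  intro d d' h
  funext i
  have := congrFun (LinearEquiv.congr_fun h 1) i
  simpa [diagonalHom_apply, Units.val_inj] using this

/-- A group `Q` acts on `Q → K` by left translations. -/
def translationHom (Q : Type*) [Group Q] : Q →* ((Q → K) ≃ₗ[F] (Q → K)) where
  toFun g := LinearEquiv.funCongrLeft F K (Equiv.mulLeft g⁻¹)
  map_one' := by ext; simp [LinearEquiv.funCongrLeft_apply, LinearMap.funLeft_apply]
  map_mul' _ _ := by
    ext; simp [LinearEquiv.funCongrLeft_apply, LinearMap.funLeft_apply, mul_assoc]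

theorem translationHom_apply {Q : Type*} [Group Q] (g : Q) (f : Q → K) (i : Q) :
    translationHom F K Q g f i = f (g⁻¹ * i) := rfl

theorem translationHom_mul_diagonalHom {Q : Type*} [Group Q] (g : Q) (d : Q → Kˣ) :
    translationHom F K Q g * diagonalHom F K Q d =
      diagonalHom F K Q (fun i => d (g⁻¹ * i)) * translationHom F K Q g := by
  ext f i
  rfl

/-- If `K` contains an element of multiplicative order `r`, then the automorphism group of a
sum of `r` copies of `K` has a non-abelian `r`-subgroup. -/
theorem exists_isPGroup_not_commute {r : ℕ} [Fact r.Prime] {ζ : Kˣ} (hζ : orderOf ζ = r) :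
    ∃ H : Subgroup ((Multiplicative (ZMod r) → K) ≃ₗ[F] (Multiplicative (ZMod r) → K)),
      IsPGroup r H ∧ ∃ x ∈ H, ∃ y ∈ H, ¬ Commute x y := by
  set Q := Multiplicative (ZMod r)
  have hr : r.Prime := Fact.out
  let E : Subgroup (Q → Kˣ) := (powMonoidHom r).ker
  have hE : IsPGroup r E := fun d => ⟨1, Subtype.ext (by rw [pow_one]; exact d.2)⟩
  have hQ : IsPGroup r Q := IsPGroup.of_card (n := 1) (by simp [Q])
  have hnormal : (translationHom F K Q).range ≤
      Subgroup.normalizer (E.map (diagonalHom F K Q) : Set _) := by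
    have hconj : ∀ (g : Q) (d : Q → Kˣ), d ∈ E →
        translationHom F K Q g * diagonalHom F K Q d * (translationHom F K Q g)⁻¹ ∈
          E.map (diagonalHom F K Q) := by
      intro g d hd
      rw [translationHom_mul_diagonalHom, mul_inv_cancel_right]
      refine ⟨_, ?_, rfl⟩
      have hd' : d ^ r = 1 := hd
      change (fun i => d (g⁻¹ * i)) ^ r = 1
      funext i
      exact congrFun hd' (g⁻¹ * i)
    rintro _ ⟨g, rfl⟩
    rw [Subgroup.mem_normalizer_iff]
    refine fun h => ⟨?_, fun hh => ?_⟩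
    · rintro ⟨d, hd, rfl⟩
      exact hconj g d hd
    · obtain ⟨d, hd, hd'⟩ := hh
      have := hconj g⁻¹ d hd
      rw [hd', map_inv] at this
      simpa [mul_assoc] using this
  refine ⟨(translationHom F K Q).range ⊔ E.map (diagonalHom F K Q),
    IsPGroup.to_sup_of_normal_right'
      (hQ.of_surjective _ (translationHom F K Q).rangeRestrict_surjective) (hE.map _) hnormal,
    diagonalHom F K Q (Pi.mulSingle 1 ζ), ?_, translationHom F K Q (.ofAdd 1), ?_, fun h => ?_⟩
  · refine Subgroup.mem_sup_right ⟨_, ?_, rfl⟩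
    change (Pi.mulSingle 1 ζ : Q → Kˣ) ^ r = 1
    rw [← Pi.mulSingle_pow, orderOf_dvd_iff_pow_eq_one.1 hζ.dvd, Pi.mulSingle_one]
  · exact Subgroup.mem_sup_left ⟨_, rfl⟩
  · have hne : ((Multiplicative.ofAdd (1 : ZMod r))⁻¹ : Q) ≠ 1 := by
      rw [Ne, inv_eq_one]
      exact fun h0 => one_ne_zero (α := ZMod r) (Multiplicative.ofAdd.injective h0)
    have h1 := congrFun (LinearEquiv.congr_fun h.eq (1 : Q → K)) (1 : Q)
    simp only [LinearEquiv.mul_apply, diagonalHom_apply, translationHom_apply, Pi.one_apply,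
      mul_one, Pi.mulSingle_eq_same, Pi.mulSingle_eq_of_ne hne, Units.val_one,
      Units.val_eq_one] at h1
    rw [h1, orderOf_one] at hζ
    exact hr.one_lt.ne hζ

end LinearGroups

section Projective

open scoped commutatorElement

variable {F : Type*} [Field F] {r n : ℕ} [Fact r.Prime]

/-- If `r` does not divide the order of `Fˣ`, then `F` has no non-trivial `r`-power roots of
unity. -/
theorem Units.eq_one_of_pow_prime_pow_eq_one (h : ¬ r ∣ Nat.card Fˣ) {u : Fˣ} {k : ℕ}
    (hu : u ^ r ^ k = 1) : u = 1 := by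
  rw [← orderOf_eq_one_iff]
  have hr : r.Prime := Fact.out
  exact Nat.Coprime.eq_one_of_dvd
    (((hr.coprime_iff_not_dvd.2 h).pow_left k).symm.coprime_dvd_left (orderOf_dvd_natCard u))
    (orderOf_dvd_of_pow_eq_one hu)

/-- If `r` does not divide the order of `Fˣ`, then the Sylow `r`-subgroups of `PSLₙ(F)` are
abelian if and only if all `r`-subgroups of `GLₙ(F)` are abelian. -/
theorem psl_sylow_isMulCommutative_iff_GL [Finite F] (h : ¬ r ∣ Nat.card Fˣ) :
    (∀ P : Sylow r (ProjectiveSpecialLinearGroup (Fin n) F),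
        IsMulCommutative (P : Subgroup (ProjectiveSpecialLinearGroup (Fin n) F))) ↔
      ∀ H : Subgroup (GL (Fin n) F), IsPGroup r H → ∀ x ∈ H, ∀ y ∈ H, Commute x y := by
  let π := QuotientGroup.mk' (Subgroup.center (SpecialLinearGroup (Fin n) F))
  constructor
  · intro hP H hH
    have hlift : ∀ x ∈ H, ∃ x' : SpecialLinearGroup (Fin n) F, x'.toGL = x := by
      intro x hx
      obtain ⟨k, hk⟩ := hH ⟨x, hx⟩
      have hk' : x ^ r ^ k = 1 := congrArg Subtype.val hk
      have hdet : GeneralLinearGroup.det x = 1 :=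
        Units.eq_one_of_pow_prime_pow_eq_one h (k := k) (by rw [← map_pow, hk', map_one])
      exact ⟨⟨x, congrArg Units.val hdet⟩, Units.ext rfl⟩
    intro x hx y hy
    obtain ⟨x, rfl⟩ := hlift x hx
    obtain ⟨y, rfl⟩ := hlift y hy
    have hH' : IsPGroup r (H.comap SpecialLinearGroup.toGL) :=
      hH.comap_of_injective _ SpecialLinearGroup.toGL_injective
    obtain ⟨P, hHP⟩ := (hH'.map π).exists_le_sylow
    have := hP P
    have hcomm : π x * π y = π y * π x := setLike_mul_comm
      (hHP ⟨x, hx, rfl⟩) (hHP ⟨y, hy, rfl⟩)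
    have hcenter : ⁅x, y⁆ ∈ Subgroup.center (SpecialLinearGroup (Fin n) F) := by
      rw [← QuotientGroup.ker_mk' (Subgroup.center _), MonoidHom.mem_ker, map_commutatorElement,
        commutatorElement_eq_one_iff_mul_comm]
      exact hcomm
    have hmem : ⁅x, y⁆ ∈ H.comap SpecialLinearGroup.toGL := by
      rw [commutatorElement_def]
      exact mul_mem (mul_mem (mul_mem hx hy) (inv_mem hx)) (inv_mem hy)
    obtain ⟨k, hk⟩ := hH' ⟨_, hmem⟩
    have hk' : ⁅x, y⁆ ^ r ^ k = 1 := congrArg Subtype.val hk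
    have hone : ⁅x, y⁆ = 1 := by
      rcases isEmpty_or_nonempty (Fin n) with _ | ⟨⟨i⟩⟩
      · exact Subsingleton.elim _ _
      obtain ⟨a, -, ha'⟩ := Matrix.SpecialLinearGroup.mem_center_iff.1 hcenter
      have hpow : scalar (Fin n) (a ^ r ^ k) = 1 := by
        rw [map_pow, ha']
        exact (Matrix.SpecialLinearGroup.coe_pow _ _).symm.trans (congrArg Subtype.val hk')
      have hak : a ^ r ^ k = 1 := by
        simpa using congrFun (congrFun hpow i) i
      have ha0 : a ≠ 0 := by
        rintro rfl
        rw [zero_pow (pow_ne_zero _ (Fact.out : r.Prime).ne_zero)] at hak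
        exact zero_ne_one hak
      have ha1 : Units.mk0 a ha0 = 1 :=
        Units.eq_one_of_pow_prime_pow_eq_one h (k := k) (Units.ext (by simpa using hak))
      have ha1' : a = 1 := congrArg Units.val ha1
      rw [ha1', map_one] at ha'
      exact Subtype.ext ha'.symm
    rw [commutatorElement_eq_one_iff_commute] at hone
    exact hone.map SpecialLinearGroup.toGL
  · intro hGL P
    obtain ⟨S, rfl⟩ := Sylow.mapSurjective_surjective
      (QuotientGroup.mk'_surjective (Subgroup.center (SpecialLinearGroup (Fin n) F))) r P
    have : IsMulCommutative (S : Subgroup (SpecialLinearGroup (Fin n) F)) :=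
      IsMulCommutative.of_setLike_mul_comm fun a ha b hb =>
        SpecialLinearGroup.toGL_injective <| by
          rw [map_mul, map_mul]
          exact hGL _ (S.2.map SpecialLinearGroup.toGL) _ ⟨a, ha, rfl⟩ _ ⟨b, hb, rfl⟩
    rw [Sylow.coe_mapSurjective]
    infer_instance

end Projective

section Orders

variable {q r : ℕ} [Fact r.Prime]

theorem dvd_pow_sub_one_iff_orderOf_dvd (hq : 0 < q) (j : ℕ) :
    r ∣ q ^ j - 1 ↔ orderOf (q : ZMod r) ∣ j := by
  rw [orderOf_dvd_iff_pow_eq_one, ← ZMod.natCast_eq_zero_iff,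
    Nat.cast_sub (Nat.one_le_pow _ _ hq), Nat.cast_pow, Nat.cast_one, sub_eq_zero]

/-- For `j < m * r`, where `m` is the order of `q` modulo `r`, the `r`-part of `q ^ j - 1` is
trivial or equal to that of `q ^ m - 1`. -/
theorem factorization_pow_sub_one (hodd : Odd r) (hq : 1 < q) (hnd : ¬ r ∣ q) {j : ℕ}
    (hj0 : 0 < j) (hj : j < orderOf (q : ZMod r) * r) :
    (q ^ j - 1).factorization r =
      if orderOf (q : ZMod r) ∣ j then (q ^ orderOf (q : ZMod r) - 1).factorization r else 0 := by
  have hr : r.Prime := Fact.out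
  split_ifs with hdvd
  · obtain ⟨k, rfl⟩ := hdvd
    have hk : k < r := lt_of_mul_lt_mul_left hj (Nat.zero_le _)
    have hk0 : k ≠ 0 := by rintro rfl; simp at hj0
    have hm0 : orderOf (q : ZMod r) ≠ 0 := by rintro h; simp [h] at hj0
    have hlte := padicValNat.pow_sub_pow (p := r) hodd (x := q ^ orderOf (q : ZMod r)) (y := 1)
      (Nat.one_lt_pow hm0 hq) ((dvd_pow_sub_one_iff_orderOf_dvd (by omega) _).2 dvd_rfl)
      (fun h => hnd (hr.dvd_of_dvd_pow h)) hk0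
    rw [padicValNat.eq_zero_of_not_dvd (n := k)
      (fun h => absurd (Nat.le_of_dvd (by omega) h) (by omega)), one_pow, ← pow_mul] at hlte
    simpa [Nat.factorization_def _ hr] using hlte
  · exact Nat.factorization_eq_zero_of_not_dvd
      (fun h => hdvd ((dvd_pow_sub_one_iff_orderOf_dvd (by omega) _).1 h))

theorem factorization_card_GL (F : Type*) [Field F] [Fintype F] (hodd : Odd r)
    (hnd : ¬ r ∣ Fintype.card F) {n : ℕ} (hn : n < orderOf (Fintype.card F : ZMod r) * r) :
    (Nat.card (GL (Fin n) F)).factorization r = (n / orderOf (Fintype.card F : ZMod r)) *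
      (Fintype.card F ^ orderOf (Fintype.card F : ZMod r) - 1).factorization r := by
  have hr : r.Prime := Fact.out
  set q := Fintype.card F
  set m := orderOf (q : ZMod r) with hm
  have hq : 1 < q := Fintype.one_lt_card
  have hpos : ∀ j, 0 < j → q ^ j - 1 ≠ 0 := fun j hj =>
    (Nat.sub_pos_of_lt (Nat.one_lt_pow hj.ne' hq)).ne'
  have hterm : ∀ i : Fin n, q ^ n - q ^ (i : ℕ) = q ^ (i : ℕ) * (q ^ (n - i) - 1) := by
    intro i
    rw [Nat.mul_sub, ← pow_add, Nat.add_sub_cancel' i.2.le, mul_one]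
  rw [card_GL_field, Nat.factorization_prod_apply]
  · have hval : ∀ i : Fin n, (q ^ n - q ^ (i : ℕ)).factorization r =
        if m ∣ n - i then (q ^ m - 1).factorization r else 0 := by
      intro i
      rw [hterm, Nat.factorization_mul (pow_ne_zero _ (by omega)) (hpos _ (by omega)),
        Finsupp.add_apply, Nat.factorization_eq_zero_of_not_dvd
          (fun h => hnd (hr.dvd_of_dvd_pow h)), zero_add,
        factorization_pow_sub_one hodd hq hnd (by omega) (by rw [← hm]; omega)]
    rw [Finset.sum_congr rfl fun i _ => hval i,
      Fin.sum_univ_eq_sum_range (fun i => if m ∣ n - i then (q ^ m - 1).factorization r else 0) n,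
      ← Finset.sum_range_reflect, Finset.sum_congr rfl (g := fun i =>
        if m ∣ i + 1 then (q ^ m - 1).factorization r else 0), ← Finset.sum_filter,
      Finset.sum_const, smul_eq_mul, Nat.card_multiples]
    intro i hi
    rw [Finset.mem_range] at hi
    rw [show n - (n - 1 - i) = i + 1 by omega]
  · intro i _
    rw [hterm]
    exact mul_ne_zero (pow_ne_zero _ (by omega)) (hpos _ (by omega))

end Orders

/-- Let `F` be a finite field of cardinality `q`, `r` an odd prime not dividing `q`, and `m ≥ 2`
the multiplicative order of `q` modulo `r`. For every `n ≥ 2`, the Sylow `r`-subgroups of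
`PSLₙ(F)` are abelian if and only if `n < m * r`. -/
theorem psl_sylow_isCommutative_iff (F : Type*) [Field F] [Fintype F] (q r m : ℕ)
    (hq : Fintype.card F = q) (hr : r.Prime) (hodd : Odd r) (hnd : ¬ r ∣ q)
    (hm : m = orderOf (q : ZMod r)) (hm2 : 2 ≤ m) (n : ℕ) (hn : 2 ≤ n) :
    (∀ P : Sylow r (ProjectiveSpecialLinearGroup (Fin n) F),
        IsMulCommutative (P : Subgroup (ProjectiveSpecialLinearGroup (Fin n) F)))
      ↔ n < m * r := by
  have : Fact r.Prime := ⟨hr⟩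
  have : NeZero m := ⟨by omega⟩
  have hq1 : 1 < q := hq ▸ Fintype.one_lt_card
  obtain ⟨p, hchar⟩ := CharP.exists F
  have : Fact p.Prime := ⟨CharP.char_is_prime F p⟩
  let K := FiniteField.Extension F p m
  have hKrank : Module.finrank F K = m := FiniteField.finrank_extension F p m
  have hKcard : Nat.card Kˣ = q ^ m - 1 := by
    rw [Nat.card_units, FiniteField.natCard_extension, Nat.card_eq_fintype_card, hq]
  have hFcard : ¬ r ∣ Nat.card Fˣ := by
    rw [Nat.card_units, Nat.card_eq_fintype_card, hq, ← pow_one q,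
      dvd_pow_sub_one_iff_orderOf_dvd (by omega), ← hm, Nat.dvd_one]
    omega
  rw [psl_sylow_isMulCommutative_iff_GL hFcard]
  constructor
  · intro hcomm
    by_contra hlt
    obtain ⟨ζ, hζ⟩ := exists_prime_orderOf_dvd_card' (G := Kˣ) r (by
      rw [hKcard, dvd_pow_sub_one_iff_orderOf_dvd (by omega), ← hm])
    obtain ⟨H, hH, x, hx, y, hy, hxy⟩ := exists_isPGroup_not_commute F K hζ
    obtain ⟨f, hf⟩ := exists_injective_linearEquiv_hom_GL F (Multiplicative (ZMod r) → K)
      (n := n) (by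
        rw [Module.finrank_pi_fintype]
        simp only [hKrank, Finset.sum_const, Finset.card_univ, Fintype.card_multiplicative,
          ZMod.card, smul_eq_mul]
        rw [mul_comm]
        omega)
    have := hcomm _ (hH.map f) _ ⟨x, hx, rfl⟩ _ ⟨y, hy, rfl⟩
    exact hxy (hf (by simpa only [map_mul] using this.eq))
  · intro hlt H hH x hx y hy
    obtain ⟨f, hf⟩ := exists_injective_linearEquiv_hom_GL F (Fin (n / m) → K) (n := n) (by
      rw [Module.finrank_pi_fintype]
      simpa [hKrank] using Nat.div_mul_le_self n m)
    refine hH.commute_of_injective_of_factorization_eq (f.comp (diagonalHom F K _))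
      (hf.comp (diagonalHom_injective F K _)) ?_ hx hy
    subst hq
    rw [hm] at hlt
    rw [factorization_card_GL F hodd hnd hlt, ← hm, Nat.card_pi]
    simp [hKcard]
end

section
/- Let F be a finite field of cardinality q, let r be an odd prime with r | q − 1, and let n ≥ 2 with r ∤ n. Then the Sylow r-subgroups of the projective special linear group PSL_n(F) are abelian (commutative) if and only if n < r. -/
open Matrix

/-- If a commutative group `A` embeds in a finite group `G` and `|A|`, `|G|` have the same
`p`-part, then every `p`-subgroup of `G` is commutative. -/
theorem IsPGroup.isMulCommutative_of_injective_of_factorization_eq {A G : Type*} [CommGroup A]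
    [Group G] [Finite G] {p : ℕ} [Fact p.Prime] (f : A →* G) (hf : Function.Injective f)
    (hcard : (Nat.card A).factorization p = (Nat.card G).factorization p)
    {H : Subgroup G} (hH : IsPGroup p H) : IsMulCommutative H := by
  have : Finite A := Finite.of_injective f hf
  obtain ⟨Q, hQ⟩ := hH.exists_le_sylow
  let T : Sylow p A := default
  let S : Sylow p G := Sylow.ofCard (T.toSubgroup.map f) (by
    rw [Subgroup.card_map_of_injective hf, ← hcard]
    exact T.card_eq_multiplicity)
  have hS : ∀ a b : S, a * b = b * a := by
    rintro ⟨_, a, -, rfl⟩ ⟨_, b, -, rfl⟩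
    exact Subtype.ext (((map_mul f a b).symm.trans (congrArg f (mul_comm a b))).trans
      (map_mul f b a))
  have hQc : ∀ a b : Q, a * b = b * a := fun a b => by
    apply (Q.equiv S).injective
    rw [map_mul, map_mul, hS]
  exact .of_setLike_mul_comm fun a ha b hb =>
    congrArg Subtype.val (hQc ⟨a, hQ ha⟩ ⟨b, hQ hb⟩)

namespace Matrix

variable {n R F : Type*} [Fintype n] [DecidableEq n] [CommRing R] [Field F]

/-- The diagonal torus of the general linear group. -/
def diagonalGL (n R : Type*) [Fintype n] [DecidableEq n] [CommRing R] : (n → Rˣ) →* GL n R :=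
  (Units.map (diagonalRingHom n R : (n → R) →* Matrix n n R)).comp
    (MulEquiv.piUnits (M := fun _ : n => R)).symm.toMonoidHom

theorem coe_diagonalGL (d : n → Rˣ) :
    (diagonalGL n R d : Matrix n n R) = diagonal fun i => (d i : R) := rfl

theorem diagonalGL_injective : Function.Injective (diagonalGL n R) :=
  (Units.map_injective diagonal_injective).comp MulEquiv.piUnits.symm.injective

/-- For an odd prime `r ∣ q - 1` and `n < r`, the diagonal torus contains a Sylow `r`-subgroup of
`GLₙ(F)`. -/
theorem factorization_card_GL_of_dvd_sub_one [Fintype F] {r m : ℕ} [Fact r.Prime] (hodd : Odd r)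
    (hdvd : r ∣ Fintype.card F - 1) (hm : m < r) :
    (Nat.card (Fin m → Fˣ)).factorization r = (Nat.card (GL (Fin m) F)).factorization r := by
  have hr : r.Prime := Fact.out
  have hq : 1 < Fintype.card F := Fintype.one_lt_card
  have hrq : ¬ r ∣ Fintype.card F := fun h => hr.one_lt.ne' <| Nat.dvd_one.mp <| by
    simpa [Nat.sub_sub_self hq.le] using Nat.dvd_sub h hdvd
  have hfac (i : Fin m) : (Fintype.card F ^ m - Fintype.card F ^ (i : ℕ)).factorization r =
      (Fintype.card F - 1).factorization r := by
    have hi : m - i ≠ 0 := by lia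
    have hsplit : Fintype.card F ^ m - Fintype.card F ^ (i : ℕ) =
        Fintype.card F ^ (i : ℕ) * (Fintype.card F ^ (m - i) - 1 ^ (m - i)) := by
      rw [one_pow, Nat.mul_sub, ← pow_add, Nat.add_sub_cancel' i.2.le, mul_one]
    have hlt : 1 < Fintype.card F ^ (m - i) := Nat.one_lt_pow hi hq
    rw [hsplit, Nat.factorization_mul (by positivity) (by rw [one_pow]; lia), Finsupp.add_apply,
      Nat.factorization_eq_zero_of_not_dvd (fun h => hrq (hr.dvd_of_dvd_pow h)), zero_add,
      Nat.factorization_def _ hr, Nat.factorization_def _ hr,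
      padicValNat.pow_sub_pow hodd hq hdvd hrq hi,
      padicValNat.eq_zero_of_not_dvd (n := m - i)
        (Nat.not_dvd_of_pos_of_lt (Nat.pos_of_ne_zero hi) (by lia)), add_zero]
  rw [card_GL_field, Nat.factorization_prod fun i _ =>
    (Nat.sub_pos_of_lt (Nat.pow_lt_pow_right hq i.2)).ne']
  simp [Finsupp.finsetSum_apply, hfac, Nat.card_pi, Nat.card_units, Nat.card_eq_fintype_card]

namespace SpecialLinearGroup

variable (n R) in
/-- Even permutations as permutation matrices of determinant one. -/
def alternatingHom : alternatingGroup n →* SpecialLinearGroup n R where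
  toFun σ := ⟨permMatrixHom (σ : Equiv.Perm n), by
    rw [permMatrixHom_apply, det_permutation, Equiv.Perm.sign_inv,
      Equiv.Perm.mem_alternatingGroup.mp σ.2, Units.val_one, Int.cast_one]⟩
  map_one' := Subtype.ext (map_one _)
  map_mul' _ _ := Subtype.ext (map_mul _ _ _)

theorem coe_alternatingHom_apply (σ : alternatingGroup n) (i j : n) :
    (alternatingHom n R σ : Matrix n n R) i j = if i = (σ : Equiv.Perm n) j then 1 else 0 := by
  change (σ : Equiv.Perm n)⁻¹.permMatrix R i j = _
  simp [eq_comm (a := i), Equiv.symm_apply_eq]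

theorem toGL_alternatingHom_mul_diagonalGL (σ : alternatingGroup n) (d : n → Rˣ) :
    toGL (alternatingHom n R σ) * diagonalGL n R d =
      diagonalGL n R (d ∘ (σ : Equiv.Perm n).symm) * toGL (alternatingHom n R σ) := by
  ext i j
  change ((alternatingHom n R σ : Matrix n n R) * (diagonalGL n R d : Matrix n n R)) i j =
    ((diagonalGL n R (d ∘ (σ : Equiv.Perm n).symm) : Matrix n n R) *
      (alternatingHom n R σ : Matrix n n R)) i j
  rw [coe_diagonalGL, coe_diagonalGL, mul_diagonal, diagonal_mul, coe_alternatingHom_apply]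
  split_ifs with h <;> simp [h]

variable (n R) in
/-- The subgroup of diagonal matrices of determinant one whose entries are `k`-th roots of unity. -/
def diagonalTorsion (k : ℕ) : Subgroup (SpecialLinearGroup n R) :=
  ((powMonoidHom k : (n → Rˣ) →* (n → Rˣ)).ker.map (diagonalGL n R)).comap toGL

theorem mem_diagonalTorsion {k : ℕ} {A : SpecialLinearGroup n R} :
    A ∈ diagonalTorsion n R k ↔ ∃ d : n → Rˣ, d ^ k = 1 ∧ diagonalGL n R d = toGL A :=
  Iff.rfl

theorem isPGroup_diagonalTorsion (p : ℕ) : IsPGroup p (diagonalTorsion n R p) := by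
  refine IsPGroup.comap_of_injective (IsPGroup.map ?_ _) _ toGL_injective
  rintro ⟨d, hd⟩
  exact ⟨1, Subtype.ext (by simpa using hd)⟩

theorem alternatingHom_conj_mem_diagonalTorsion (σ : alternatingGroup n) {k : ℕ}
    {A : SpecialLinearGroup n R} (hA : A ∈ diagonalTorsion n R k) :
    alternatingHom n R σ * A * (alternatingHom n R σ)⁻¹ ∈ diagonalTorsion n R k := by
  obtain ⟨d, hd, hdA⟩ := mem_diagonalTorsion.mp hA
  refine mem_diagonalTorsion.mpr ⟨d ∘ (σ : Equiv.Perm n).symm, ?_, ?_⟩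
  · ext i
    exact congrArg Units.val (congrFun hd _)
  · rw [map_mul, map_mul, ← hdA, toGL_alternatingHom_mul_diagonalGL, map_inv, mul_inv_cancel_right]

theorem alternatingHom_mem_normalizer_diagonalTorsion (σ : alternatingGroup n) (k : ℕ) :
    alternatingHom n R σ ∈ Subgroup.normalizer (diagonalTorsion n R k : Set _) := by
  refine Subgroup.mem_normalizer_iff.mpr fun A =>
    ⟨alternatingHom_conj_mem_diagonalTorsion σ, fun h => ?_⟩
  have := alternatingHom_conj_mem_diagonalTorsion σ⁻¹ h
  simpa only [map_inv, inv_inv, mul_assoc, inv_mul_cancel, inv_mul_cancel_left, mul_one] using this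

/-- An even permutation of order `p` together with the diagonal `p`-torsion generates a
`p`-group. -/
theorem isPGroup_zpowers_alternatingHom_sup_diagonalTorsion {p : ℕ} (σ : alternatingGroup n)
    (hσ : σ ^ p = 1) :
    IsPGroup p (Subgroup.zpowers (alternatingHom n R σ) ⊔ diagonalTorsion n R p :
      Subgroup (SpecialLinearGroup n R)) := by
  refine IsPGroup.to_sup_of_normal_right' ?_ (isPGroup_diagonalTorsion p) ?_
  · rw [← MonoidHom.map_zpowers]
    refine IsPGroup.map ?_ _
    rintro ⟨τ, hτ⟩
    obtain ⟨k, rfl⟩ := Subgroup.mem_zpowers_iff.mp hτ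
    exact ⟨1, Subtype.ext (by
      rw [pow_one, Subgroup.coe_pow, Subgroup.coe_one, ← zpow_natCast, zpow_comm, zpow_natCast, hσ]
      exact _root_.one_zpow k)⟩
  · exact Subgroup.zpowers_le.mpr (alternatingHom_mem_normalizer_diagonalTorsion σ p)

/-- If an even permutation with a fixed point moves `i`, and `ζ ^ 2 ≠ 1` for some `p`-th root of
unity `ζ`, then its permutation matrix fails to commute in `PSL` with the image of some diagonal
`p`-torsion matrix. -/
theorem exists_mem_diagonalTorsion_not_commute {p : ℕ} (σ : alternatingGroup n)
    {i j : n} (hi : (σ : Equiv.Perm n) i ≠ i) (hj : (σ : Equiv.Perm n) j = j)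
    {ζ : Rˣ} (hζ : ζ ^ p = 1) (hζ2 : ζ ^ 2 ≠ 1) :
    ∃ A ∈ diagonalTorsion n R p, ¬ Commute
      (alternatingHom n R σ : ProjectiveSpecialLinearGroup n R)
      (A : ProjectiveSpecialLinearGroup n R) := by
  let d : n → Rˣ := Pi.mulSingle i ζ * Pi.mulSingle ((σ : Equiv.Perm n) i) ζ⁻¹
  have hdet : (diagonalGL n R d : Matrix n n R).det = 1 := by
    rw [coe_diagonalGL, det_diagonal, ← Units.coe_prod]
    simp [d, Finset.prod_mul_distrib]
  let A : SpecialLinearGroup n R := ⟨diagonalGL n R d, hdet⟩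
  refine ⟨A, mem_diagonalTorsion.mpr ⟨d, ?_, Units.ext rfl⟩, fun h => ?_⟩
  · simp [d, mul_pow, ← Pi.mulSingle_pow, hζ]
  have hz : (alternatingHom n R σ * A)⁻¹ * (A * alternatingHom n R σ) ∈
      Subgroup.center (SpecialLinearGroup n R) := QuotientGroup.eq.mp h.eq
  obtain ⟨c, -, hc⟩ := mem_center_iff.mp hz
  have hmul : (A * alternatingHom n R σ : Matrix n n R) =
      alternatingHom n R σ * A * scalar n c := by
    rw [hc, ← coe_mul, ← coe_mul, ← coe_mul, mul_inv_cancel_left]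
  have key (k : n) : (d ((σ : Equiv.Perm n) k) : R) = d k * c := by
    have := congrFun₂ hmul ((σ : Equiv.Perm n) k) k
    change ((diagonalGL n R d : Matrix n n R) * (alternatingHom n R σ : Matrix n n R)) _ _ =
      ((alternatingHom n R σ : Matrix n n R) * (diagonalGL n R d : Matrix n n R) *
        scalar n c) _ _ at this
    simpa [coe_diagonalGL, coe_alternatingHom_apply, mul_diagonal, diagonal_mul] using this
  have hji : j ≠ i := fun h => hi (h ▸ hj)
  have hjσ : j ≠ (σ : Equiv.Perm n) i := fun h =>
    hji ((σ : Equiv.Perm n).injective (hj.trans h))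
  have hc1 : c = 1 := by
    simpa [d, hj, Pi.mulSingle_eq_of_ne hji, Pi.mulSingle_eq_of_ne hjσ] using (key j).symm
  have hi' : d ((σ : Equiv.Perm n) i) = d i := Units.ext (by simpa [hc1] using key i)
  have : ζ⁻¹ = ζ := by
    simpa [d, Pi.mulSingle_eq_of_ne hi, Pi.mulSingle_eq_of_ne hi.symm] using hi'
  exact hζ2 (by rw [pow_two, ← inv_eq_iff_mul_eq_one, this])

end SpecialLinearGroup

end Matrix

/-- For an odd prime `r < n` there is an even permutation of `Fin n` of order dividing `r` that is
nontrivial and has a fixed point. -/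
theorem exists_alternatingGroup_pow_eq_one_of_lt {r n : ℕ} (hr : r.Prime) (hodd : Odd r)
    (hrn : r < n) :
    ∃ σ : alternatingGroup (Fin n), σ ^ r = 1 ∧ (∃ i, (σ : Equiv.Perm (Fin n)) i ≠ i) ∧
      ∃ j, (σ : Equiv.Perm (Fin n)) j = j := by
  have : NeZero n := ⟨by lia⟩
  let m : Fin n := ⟨r - 1, by lia⟩
  have hm : m ≠ 0 := fun h => by
    have hval : r - 1 = 0 := congrArg Fin.val h
    have := hr.two_le
    lia
  have hord : orderOf (Fin.cycleRange m) = r := by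
    rw [← Equiv.Perm.lcm_cycleType, Fin.cycleType_cycleRange hm]
    simp [m, Nat.sub_add_cancel hr.one_le]
  refine ⟨⟨Fin.cycleRange m, ?_⟩, Subtype.ext ?_, ⟨m, ?_⟩, ⟨⟨r, hrn⟩, ?_⟩⟩
  · rw [Equiv.Perm.mem_alternatingGroup, Fin.sign_cycleRange]
    exact Even.neg_one_pow (Nat.Odd.sub_odd hodd odd_one)
  · exact orderOf_dvd_iff_pow_eq_one.mp hord.dvd
  · simpa using hm.symm
  · exact Fin.cycleRange_of_gt (Fin.lt_def.mpr (Nat.sub_lt hr.pos one_pos))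

/-- Let `F` be a finite field of cardinality `q`, `r` an odd prime with `r ∣ q - 1`, and
`n ≥ 2` with `r ∤ n`. The Sylow `r`-subgroups of `PSLₙ(F)` are abelian if and only if `n < r`. -/
theorem psl_sylow_isCommutative_iff_of_dvd_sub_one (F : Type*) [Field F] [Fintype F] (q r n : ℕ)
    (hq : Fintype.card F = q) (hr : r.Prime) (hodd : Odd r) (hdvd : r ∣ q - 1)
    (hn : 2 ≤ n) (hrn : ¬ r ∣ n) :
    (∀ P : Sylow r (ProjectiveSpecialLinearGroup (Fin n) F),
        IsMulCommutative (P : Subgroup (ProjectiveSpecialLinearGroup (Fin n) F)))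
      ↔ n < r := by
  subst hq
  have : Fact r.Prime := ⟨hr⟩
  constructor
  · intro hcomm
    by_contra! hle
    have hlt : r < n := hle.lt_of_ne fun h => hrn h.dvd
    obtain ⟨σ, hσ, ⟨i, hi⟩, j, hj⟩ := exists_alternatingGroup_pow_eq_one_of_lt hr hodd hlt
    obtain ⟨ζ, hζ⟩ := exists_prime_orderOf_dvd_card' (G := Fˣ) r (by
      rwa [Nat.card_units, Nat.card_eq_fintype_card])
    have hζ2 : ζ ^ 2 ≠ 1 := fun h => by
      have h2 := Nat.le_of_dvd two_pos (hζ ▸ orderOf_dvd_of_pow_eq_one h)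
      have := hr.two_le
      obtain ⟨k, hk⟩ := hodd
      lia
    obtain ⟨A, hA, hnot⟩ := SpecialLinearGroup.exists_mem_diagonalTorsion_not_commute σ hi hj
      (hζ ▸ pow_orderOf_eq_one ζ) hζ2
    obtain ⟨P, hP⟩ := ((SpecialLinearGroup.isPGroup_zpowers_alternatingHom_sup_diagonalTorsion
      (R := F) σ hσ).map (QuotientGroup.mk' (Subgroup.center _))).exists_le_sylow
    have := hcomm P
    exact hnot (setLike_mul_comm
      (hP (Subgroup.mem_map_of_mem _ (Subgroup.mem_sup_left (Subgroup.mem_zpowers _))))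
      (hP (Subgroup.mem_map_of_mem _ (Subgroup.mem_sup_right hA))))
  · intro hlt P
    obtain ⟨Q, rfl⟩ := Sylow.mapSurjective_surjective
      (QuotientGroup.mk'_surjective (Subgroup.center (SpecialLinearGroup (Fin n) F))) r P
    have hmap := IsPGroup.isMulCommutative_of_injective_of_factorization_eq (diagonalGL (Fin n) F)
      diagonalGL_injective (factorization_card_GL_of_dvd_sub_one hodd hdvd hlt)
      (Q.isPGroup'.map SpecialLinearGroup.toGL)
    have hQ : IsMulCommutative Q.toSubgroup := by
      rw [← Subgroup.comap_map_eq_self_of_injective SpecialLinearGroup.toGL_injective Q.toSubgroup]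
      exact Subgroup.comap_injective_isMulCommutative _ SpecialLinearGroup.toGL_injective
    rw [Sylow.coe_mapSurjective]
    infer_instance
end

section
/- Let F be a finite field of cardinality q with 3 | q − 1. Then the Sylow 3-subgroups of the projective special linear group PSL_3(F) are abelian (commutative) if and only if 9 ∤ q − 1, i.e., if and only if q ≡ 4 or 7 (mod 9). -/
open Matrix

/-- A finite field with `q` elements contains a primitive `n`-th root of unity
for each divisor `n` of `q - 1`. -/
theorem FiniteField.exists_isPrimitiveRoot_of_dvd (F : Type*) [Field F] [Fintype F] {n : ℕ}
    (hn : n ∣ Fintype.card F - 1) : ∃ ζ : F, IsPrimitiveRoot ζ n := by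
  obtain ⟨g, hg⟩ := IsCyclic.exists_ofOrder_eq_natCard (α := Fˣ)
  rw [Nat.card_units, Nat.card_eq_fintype_card] at hg
  obtain ⟨m, hm⟩ := hn
  have hpos : 0 < Fintype.card F - 1 := Nat.sub_pos_of_lt Fintype.one_lt_card
  have hprim : IsPrimitiveRoot (g : F) (Fintype.card F - 1) :=
    IsPrimitiveRoot.coe_units_iff.mpr (hg ▸ IsPrimitiveRoot.orderOf g)
  exact ⟨(g : F) ^ m, hprim.pow hpos (by rw [hm, mul_comm])⟩

namespace Matrix

/-- The order of `GL n F` is the order of `SL n F` times the number of units of `F`. -/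
theorem card_specialLinearGroup_mul_card_units (n F : Type*) [Fintype n] [DecidableEq n]
    [Nonempty n] [CommRing F] :
    Nat.card (SpecialLinearGroup n F) * Nat.card Fˣ = Nat.card (GL n F) := by
  have hker : (SpecialLinearGroup.toGL (n := n) (R := F)).range =
      (GeneralLinearGroup.det (n := n) (R := F)).ker := by
    ext g
    rw [MonoidHom.mem_range, MonoidHom.mem_ker, Units.ext_iff]
    constructor
    · rintro ⟨s, rfl⟩
      exact s.2
    · intro h
      exact ⟨⟨g, h⟩, Units.ext rfl⟩
  rw [Nat.card_congr
      (MonoidHom.ofInjective (SpecialLinearGroup.toGL_injective (n := n) (R := F))).toEquiv, hker,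
    ← Nat.card_congr
      (QuotientGroup.quotientKerEquivOfSurjective (GeneralLinearGroup.det (n := n) (R := F))
        GeneralLinearGroup.det_surjective).toEquiv,
    mul_comm, ← Subgroup.card_eq_card_quotient_mul_card_subgroup]

/-- If `F` has a primitive cube root of unity, the center of `SL₃(F)` has order `3`. -/
theorem card_center_specialLinearGroup_fin_three {F : Type*} [Field F] {ζ : F}
    (hζ : IsPrimitiveRoot ζ 3) :
    Nat.card (Subgroup.center (SpecialLinearGroup (Fin 3) F)) = 3 := by
  rw [Nat.card_congr (SpecialLinearGroup.center_equiv_rootsOfUnity' (0 : Fin 3)).toEquiv,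
    Fintype.card_fin, hζ.card_rootsOfUnity]

/-- The order of `PSL₃(F)` for a field with `3 * k + 1` elements. -/
theorem card_projectiveSpecialLinearGroup_fin_three (F : Type*) [Field F] [Fintype F] {k : ℕ}
    (hk : Fintype.card F = 3 * k + 1) :
    Nat.card (ProjectiveSpecialLinearGroup (Fin 3) F) =
      3 ^ 2 * ((3 * k + 1) ^ 3 * k ^ 2 * (3 * k + 2) * (3 * k ^ 2 + 3 * k + 1)) := by
  obtain ⟨ζ, hζ⟩ := FiniteField.exists_isPrimitiveRoot_of_dvd F (n := 3) ⟨k, by omega⟩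
  have hkpos : 0 < k := by
    have := Fintype.one_lt_card (α := F)
    omega
  have hSL := card_specialLinearGroup_mul_card_units (Fin 3) F
  have hPSL := Subgroup.card_eq_card_quotient_mul_card_subgroup
    (Subgroup.center (SpecialLinearGroup (Fin 3) F))
  rw [card_center_specialLinearGroup_fin_three hζ] at hPSL
  rw [card_GL_field, Nat.card_units, Nat.card_eq_fintype_card (α := F), hk, hPSL,
    Fin.prod_univ_three, Nat.add_sub_cancel] at hSL
  have h₀ : (3 * k + 1) ^ 3 - (3 * k + 1) ^ ((0 : Fin 3) : ℕ) =
      9 * k * (3 * k ^ 2 + 3 * k + 1) :=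
    Nat.sub_eq_of_eq_add (by simp; ring)
  have h₁ : (3 * k + 1) ^ 3 - (3 * k + 1) ^ ((1 : Fin 3) : ℕ) =
      (3 * k + 1) * (3 * k) * (3 * k + 2) :=
    Nat.sub_eq_of_eq_add (by simp; ring)
  have h₂ : (3 * k + 1) ^ 3 - (3 * k + 1) ^ ((2 : Fin 3) : ℕ) = (3 * k + 1) ^ 2 * (3 * k) :=
    Nat.sub_eq_of_eq_add (by simp; ring)
  rw [h₀, h₁, h₂] at hSL
  refine Nat.eq_of_mul_eq_mul_right (show 0 < 9 * k by omega) ?_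
  linear_combination hSL

/-- If `q = 3 * k + 1` with `3 ∤ k`, the Sylow `3`-subgroups of `PSL₃(F)` have order `9`. -/
theorem card_sylow_three_projectiveSpecialLinearGroup (F : Type*) [Field F] [Fintype F] {k : ℕ}
    (hk : Fintype.card F = 3 * k + 1) (hk3 : ¬ 3 ∣ k)
    (P : Sylow 3 (ProjectiveSpecialLinearGroup (Fin 3) F)) : Nat.card P = 3 ^ 2 := by
  have hp : Nat.Prime 3 := Nat.prime_three
  have hndvd : ¬ 3 ∣ (3 * k + 1) ^ 3 * k ^ 2 * (3 * k + 2) * (3 * k ^ 2 + 3 * k + 1) := by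
    rw [hp.dvd_mul, hp.dvd_mul, hp.dvd_mul]
    rintro (((h | h) | h) | h)
    · have := hp.dvd_of_dvd_pow h
      omega
    · exact hk3 (hp.dvd_of_dvd_pow h)
    · omega
    · omega
  have hne := ne_of_apply_ne (3 ∣ ·) fun h ↦ hndvd (h.mpr (dvd_zero 3))
  rw [P.card_eq_multiplicity, card_projectiveSpecialLinearGroup_fin_three F hk,
    Nat.factorization_mul (by norm_num) hne, Finsupp.add_apply,
    hp.factorization_pow, Finsupp.single_eq_same, Nat.factorization_eq_zero_of_not_dvd hndvd]

namespace SpecialLinearGroup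

/-- The diagonal matrices of determinant `1` whose entries are `m`-th roots of unity. -/
def diagonalRootsOfUnity (n F : Type*) [Fintype n] [DecidableEq n] [CommRing F] (m : ℕ)
    [NeZero m] : Subgroup (SpecialLinearGroup n F) where
  carrier := {A | ∃ d : n → F, (A : Matrix n n F) = diagonal d ∧ d ^ m = 1}
  one_mem' := ⟨1, by simp, one_pow m⟩
  mul_mem' := by
    rintro A B ⟨d, hA, hd⟩ ⟨e, hB, he⟩
    exact ⟨d * e, by rw [coe_mul, hA, hB, diagonal_mul_diagonal']; rfl,
      by rw [mul_pow, hd, he, one_mul]⟩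
  inv_mem' := by
    rintro A ⟨d, hA, hd⟩
    refine ⟨d ^ (m - 1), ?_, by rw [← pow_mul, mul_comm, pow_mul, hd, one_pow]⟩
    have hinv : A⁻¹ = A ^ (m - 1) := by
      refine inv_eq_of_mul_eq_one_left (Subtype.ext ?_)
      rw [pow_sub_one_mul (NeZero.ne m), coe_pow, hA, diagonal_pow, hd]
      exact diagonal_one
    rw [hinv, coe_pow, hA, diagonal_pow]

theorem isPGroup_diagonalRootsOfUnity (n F : Type*) [Fintype n] [DecidableEq n] [CommRing F]
    (p k : ℕ) [NeZero (p ^ k)] : IsPGroup p (diagonalRootsOfUnity n F (p ^ k)) := by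
  rintro ⟨A, d, hA, hd⟩
  refine ⟨k, Subtype.ext (Subtype.ext ?_)⟩
  change ((A ^ p ^ k : SpecialLinearGroup n F) : Matrix n n F) = 1
  rw [coe_pow, hA, diagonal_pow, hd]
  exact diagonal_one

/-- The cyclic permutation matrix of order `3`. -/
def cyclicPermutation (F : Type*) [CommRing F] : SpecialLinearGroup (Fin 3) F :=
  ⟨!![0, 1, 0; 0, 0, 1; 1, 0, 0], by simp [det_fin_three]⟩

theorem coe_cyclicPermutation (F : Type*) [CommRing F] :
    (cyclicPermutation F : Matrix (Fin 3) (Fin 3) F) = !![0, 1, 0; 0, 0, 1; 1, 0, 0] :=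
  rfl

theorem cyclicPermutation_pow_three (F : Type*) [CommRing F] : cyclicPermutation F ^ 3 = 1 := by
  ext i j
  rw [coe_pow, coe_cyclicPermutation]
  fin_cases i <;> fin_cases j <;> simp [pow_succ, Matrix.mul_apply, Fin.sum_univ_three]

theorem cyclicPermutation_mul_diagonal {F : Type*} [CommRing F] (d : Fin 3 → F) :
    (cyclicPermutation F : Matrix (Fin 3) (Fin 3) F) * diagonal d =
      diagonal (fun i ↦ d (i + 1)) * (cyclicPermutation F : Matrix (Fin 3) (Fin 3) F) := by
  ext i j
  rw [mul_diagonal, diagonal_mul, coe_cyclicPermutation]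
  fin_cases i <;> fin_cases j <;> simp

theorem cyclicPermutation_conj_mem {F : Type*} [CommRing F] {m : ℕ} [NeZero m]
    {A : SpecialLinearGroup (Fin 3) F} (hA : A ∈ diagonalRootsOfUnity (Fin 3) F m) :
    cyclicPermutation F * A * (cyclicPermutation F)⁻¹ ∈ diagonalRootsOfUnity (Fin 3) F m := by
  obtain ⟨d, hA, hd⟩ := hA
  refine ⟨fun i ↦ d (i + 1), ?_, funext fun i ↦ congrFun hd (i + 1)⟩
  rw [coe_mul, coe_mul, hA, cyclicPermutation_mul_diagonal, Matrix.mul_assoc, ← coe_mul,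
    mul_inv_cancel, coe_one, Matrix.mul_one]

theorem cyclicPermutation_mem_normalizer (F : Type*) [CommRing F] (m : ℕ) [NeZero m] :
    cyclicPermutation F ∈ Subgroup.normalizer (diagonalRootsOfUnity (Fin 3) F m) := by
  refine Subgroup.mem_normalizer_iff.mpr fun A ↦ ⟨cyclicPermutation_conj_mem, fun h ↦ ?_⟩
  have h3 := cyclicPermutation_conj_mem (cyclicPermutation_conj_mem h)
  set w := cyclicPermutation F
  have hw3 : w ^ 3 = 1 := cyclicPermutation_pow_three F
  have hconj : w * (w * (w * A * w⁻¹) * w⁻¹) * w⁻¹ = w ^ 3 * A * (w ^ 3)⁻¹ := by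
    rw [pow_three]
    group
  rwa [hconj, hw3, one_mul, inv_one, mul_one] at h3

/-- The diagonal matrices with entries of order dividing `3 ^ k`, together with the cyclic
permutation matrix, generate a `3`-subgroup of `SL₃(F)`. -/
theorem isPGroup_diagonalRootsOfUnity_sup_zpowers (F : Type*) [CommRing F] (k : ℕ) :
    IsPGroup 3 (diagonalRootsOfUnity (Fin 3) F (3 ^ k) ⊔
      Subgroup.zpowers (cyclicPermutation F) : Subgroup (SpecialLinearGroup (Fin 3) F)) := by
  refine (isPGroup_diagonalRootsOfUnity (Fin 3) F 3 k).to_sup_of_normal_left' ?_ ?_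
  · rintro ⟨A, i, rfl⟩
    refine ⟨1, Subtype.ext ?_⟩
    change ((cyclicPermutation F) ^ i) ^ 3 ^ 1 = 1
    rw [pow_one, ← zpow_natCast, zpow_comm, zpow_natCast, cyclicPermutation_pow_three,
      _root_.one_zpow]
  · rw [Subgroup.zpowers_le]
    exact cyclicPermutation_mem_normalizer F _

/-- If the diagonal matrix `diag(d₀, d₁, d₂)` commutes with the cyclic permutation matrix up to a
central factor, then `d` is a geometric progression. -/
theorem mul_self_eq_of_mk_commute_cyclicPermutation {F : Type*} [Field F]
    {A : SpecialLinearGroup (Fin 3) F} {d : Fin 3 → F} (hA : (A : Matrix _ _ F) = diagonal d)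
    (h : ((A * cyclicPermutation F : SpecialLinearGroup (Fin 3) F) :
        ProjectiveSpecialLinearGroup (Fin 3) F) =
      ((cyclicPermutation F * A : SpecialLinearGroup (Fin 3) F) :
        ProjectiveSpecialLinearGroup (Fin 3) F)) :
    d 1 * d 1 = d 0 * d 2 := by
  obtain ⟨r, -, hr⟩ := mem_center_iff.mp (QuotientGroup.eq.mp h)
  have hmul : (cyclicPermutation F : Matrix _ _ F) * diagonal d =
      diagonal d * (cyclicPermutation F : Matrix _ _ F) * scalar (Fin 3) r := by
    rw [hr, ← hA, ← coe_mul, ← coe_mul, ← coe_mul, mul_inv_cancel_left]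
  have h01 := congrFun (congrFun hmul 0) 1
  have h12 := congrFun (congrFun hmul 1) 2
  simp only [scalar_apply, mul_diagonal, diagonal_mul, coe_cyclicPermutation] at h01 h12
  simp at h01 h12
  rw [h12]
  linear_combination d 1 * h01

end SpecialLinearGroup

/-- If `F` has a primitive ninth root of unity, some Sylow `3`-subgroup of `PSL₃(F)` is not
commutative. -/
theorem exists_sylow_three_not_isMulCommutative {F : Type*} [Field F] {ζ : F}
    (hζ : IsPrimitiveRoot ζ 9) :
    ∃ P : Sylow 3 (ProjectiveSpecialLinearGroup (Fin 3) F),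
      ¬ IsMulCommutative (P : Subgroup (ProjectiveSpecialLinearGroup (Fin 3) F)) := by
  set w := SpecialLinearGroup.cyclicPermutation F
  let D : SpecialLinearGroup (Fin 3) F :=
    ⟨diagonal ![ζ, ζ ^ 8, 1], by
      rw [det_diagonal, Fin.prod_univ_three]
      simpa [← pow_succ'] using hζ.pow_eq_one⟩
  have hD : D ∈ SpecialLinearGroup.diagonalRootsOfUnity (Fin 3) F (3 ^ 2) := by
    refine ⟨_, rfl, funext fun i ↦ ?_⟩
    fin_cases i
    · simpa using hζ.pow_eq_one
    · change (ζ ^ 8) ^ 9 = 1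
      rw [pow_right_comm, hζ.pow_eq_one, one_pow]
    · simp
  obtain ⟨P, hP⟩ := ((SpecialLinearGroup.isPGroup_diagonalRootsOfUnity_sup_zpowers F 2).map
    (QuotientGroup.mk' (Subgroup.center (SpecialLinearGroup (Fin 3) F)))).exists_le_sylow
  refine ⟨P, fun hcomm ↦ ?_⟩
  have hDP := hP (Subgroup.mem_map_of_mem _ (Subgroup.mem_sup_left hD))
  have hwP := hP (Subgroup.mem_map_of_mem _
    (Subgroup.mem_sup_right (Subgroup.mem_zpowers w)))
  have hDw := congrArg Subtype.val (hcomm.is_comm.comm ⟨_, hDP⟩ ⟨_, hwP⟩)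
  have hmul : ζ ^ 8 * ζ ^ 8 = ζ * 1 :=
    SpecialLinearGroup.mul_self_eq_of_mk_commute_cyclicPermutation (A := D) rfl hDw
  have hpow : ζ ^ 3 = 1 := by
    linear_combination (ζ ^ 9 + 1) * hζ.pow_eq_one - ζ ^ 2 * hmul
  exact hζ.pow_ne_one_of_pos_of_lt (by norm_num) (by norm_num) hpow

end Matrix

/-- Let `F` be a finite field of cardinality `q` with `3 ∣ q - 1`. The Sylow `3`-subgroups of
`PSL₃(F)` are abelian if and only if `9 ∤ q - 1` (equivalently, `q ≡ 4` or `7 (mod 9)`). -/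
theorem psl_three_sylow_three_isCommutative_iff (F : Type*) [Field F] [Fintype F] (q : ℕ)
    (hq : Fintype.card F = q) (hdvd : 3 ∣ q - 1) :
    (∀ P : Sylow 3 (ProjectiveSpecialLinearGroup (Fin 3) F),
        IsMulCommutative (P : Subgroup (ProjectiveSpecialLinearGroup (Fin 3) F)))
      ↔ ¬ (9 ∣ q - 1) := by
  subst hq
  constructor
  · intro hcomm h9
    obtain ⟨ζ, hζ⟩ := FiniteField.exists_isPrimitiveRoot_of_dvd F h9
    obtain ⟨P, hP⟩ := exists_sylow_three_not_isMulCommutative hζ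
    exact hP (hcomm P)
  · intro h9 P
    obtain ⟨k, hk⟩ := hdvd
    have hcard : Fintype.card F = 3 * k + 1 := by
      have := Fintype.one_lt_card (α := F)
      omega
    exact IsPGroup.isMulCommutative_of_card_eq_prime_sq
      (card_sylow_three_projectiveSpecialLinearGroup F hcard (by omega) P)
end

section
/- Let F be a finite field of cardinality q, let r be an odd prime not dividing q, let m be the multiplicative order of q modulo r, and let n ≥ 2. Then the Sylow r-subgroups of the symplectic group Sp_{2n}(F) are abelian (commutative) if and only if 2n < lcm(2, m·r). -/
open Matrix

theorem IsPGroup.exists_mem_center_mem_commutator_orderOf_eq {G : Type*} [Group G] [Finite G]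
    {r : ℕ} [Fact r.Prime] (hG : IsPGroup r G) (hcomm : ¬ IsMulCommutative G) :
    ∃ z ∈ Subgroup.center G, z ∈ commutator G ∧ orderOf z = r := by
  have hnil : Group.IsNilpotent G := hG.isNilpotent
  set H : Subgroup G := Subgroup.center G ⊓ commutator G with hH
  have hne : H ≠ ⊥ := by
    intro hbot
    obtain ⟨c, hc⟩ := Subgroup.nilpotent_iff_lowerCentralSeries.mp hnil
    have key : ∀ j, (⊤ : Subgroup G).lowerCentralSeries (j + 1) = ⊥ → commutator G = ⊥ := by
      intro j
      induction j with
      | zero => exact id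
      | succ j ih =>
        intro h
        apply ih
        rw [eq_bot_iff, ← hbot, hH]
        refine le_inf ?_ ?_
        · rw [← Subgroup.centralizer_univ, ← Subgroup.coe_top,
            ← Subgroup.commutator_eq_bot_iff_le_centralizer]
          exact h
        · rw [← Subgroup.top_lowerCentralSeries_one]
          exact Subgroup.lowerCentralSeries_antitone _ (by omega)
    have h1 := key c (eq_bot_iff.mpr (hc ▸ Subgroup.lowerCentralSeries_antitone _ (Nat.le_succ c)))
    apply hcomm
    exact (commutator_eq_bot_iff G).mp h1
  have : Nontrivial H := (Subgroup.nontrivial_iff_ne_bot H).mpr hne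
  have hdvd : r ∣ Nat.card H := by
    obtain ⟨k, hk, hk'⟩ := (hG.to_subgroup H).nontrivial_iff_card.mp this
    rw [hk']
    exact dvd_pow_self r hk.ne'
  obtain ⟨z, hz⟩ := exists_prime_orderOf_dvd_card' r hdvd
  exact ⟨z, z.2.1, z.2.2, by rw [Subgroup.orderOf_coe, hz]⟩

theorem pow_finrank_eigenspace_eq_one {G K V : Type*} [Group G] [Field K] [AddCommGroup V]
    [Module K V] (ρ : G →* Module.End K V) {z : G} (hz : z ∈ Subgroup.center G)
    (hz' : z ∈ commutator G) (ζ : K) :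
    ζ ^ Module.finrank K (Module.End.eigenspace (ρ z) ζ) = 1 := by
  set E := Module.End.eigenspace (ρ z) ζ
  have hE : ∀ g, ∀ v ∈ E, ρ g v ∈ E := by
    intro g v hv
    rw [Module.End.mem_eigenspace_iff] at hv ⊢
    rw [← Module.End.mul_apply, ← map_mul, ← Subgroup.mem_center_iff.mp hz g, map_mul,
      Module.End.mul_apply, hv, map_smul]
  let σ : G →* Module.End K E :=
    { toFun := fun g => (ρ g).restrict (hE g)
      map_one' := by ext; simp
      map_mul' := by intro g h; ext; simp }
  let δ : G →* Kˣ := MonoidHom.toHomUnits (LinearMap.det.comp σ)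
  have h1 : δ z = 1 := Abelianization.commutator_subset_ker δ hz'
  have h2 : σ z = ζ • LinearMap.id := by
    ext v
    simpa [σ] using Module.End.mem_eigenspace_iff.mp v.2
  have h3 : LinearMap.det (σ z) = 1 := congrArg Units.val h1
  rw [h2, LinearMap.det_smul] at h3
  simpa using h3

theorem Module.End.sum_finrank_eigenspace_le {K V : Type*} [Field K] [AddCommGroup V]
    [Module K V] [FiniteDimensional K V] (f : Module.End K V) (s : Finset K) :
    ∑ ζ ∈ s, Module.finrank K (f.eigenspace ζ) ≤ Module.finrank K V := by
  classical
  have hind : iSupIndep fun ζ : s => f.eigenspace (ζ : K) :=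
    f.eigenspaces_iSupIndep.comp Subtype.val_injective
  have h := LinearMap.finrank_le_finrank_of_injective (iSupIndep.dfinsupp_lsum_injective hind)
  rw [← Finset.sum_coe_sort]
  rw [← Module.finrank_directSum]
  exact h

theorem Module.End.exists_hasEigenvalue_ne_one {K V : Type*} [Field K] [IsAlgClosed K]
    [AddCommGroup V] [Module K V] [FiniteDimensional K V] {f : Module.End K V} {r : ℕ}
    (hr : 1 < r) (hrK : (r : K) ≠ 0) (hf : f ^ r = 1) (hf1 : f ≠ 1) :
    ∃ ζ : K, f.HasEigenvalue ζ ∧ ζ ^ r = 1 ∧ ζ ≠ 1 := by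
  set Q : Polynomial K := ∑ i ∈ Finset.range r, Polynomial.X ^ i with hQ
  have hgeom : Q * (Polynomial.X - 1) = Polynomial.X ^ r - 1 := geom_sum_mul _ _
  have hnu : ¬ IsUnit (Polynomial.aeval f Q) := by
    intro hu
    have h := congrArg (Polynomial.aeval f) hgeom
    simp only [map_mul, map_sub, map_pow, Polynomial.aeval_X, map_one, hf, sub_self] at h
    exact hf1 (sub_eq_zero.mp (hu.mul_right_eq_zero.mp h))
  have hdeg : 0 < Q.degree := by
    rw [← Polynomial.natDegree_pos_iff_degree_pos]
    refine lt_of_lt_of_le one_pos (Polynomial.le_natDegree_of_ne_zero ?_)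
    simp [hQ, Polynomial.coeff_X_pow, hr]
  have h0 : (0 : K) ∈ spectrum K (Polynomial.aeval f Q) := by
    rwa [spectrum.zero_mem_iff]
  rw [spectrum.map_polynomial_aeval_of_degree_pos f Q hdeg] at h0
  obtain ⟨ζ, hζ, h0⟩ := h0
  refine ⟨ζ, Module.End.hasEigenvalue_iff_mem_spectrum.mpr hζ, ?_, ?_⟩
  · have h := congrArg (Polynomial.eval ζ) hgeom
    simp only [Polynomial.eval_mul, h0, zero_mul] at h
    exact sub_eq_zero.mp (by simpa using h.symm)
  · rintro rfl
    simp [hQ, Polynomial.eval_finsetSum] at h0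
    exact hrK h0

theorem Matrix.hasEigenvalue_pow_card {ι F K : Type*} [Fintype ι] [DecidableEq ι] [Field F]
    [Fintype F] [Field K] [Algebra F K] (M : Matrix ι ι F) {ζ : K}
    (h : Module.End.HasEigenvalue (toLin' (M.map (algebraMap F K))) ζ) :
    Module.End.HasEigenvalue (toLin' (M.map (algebraMap F K))) (ζ ^ Fintype.card F) := by
  obtain ⟨v, hv, hv0⟩ := h.exists_hasEigenvector
  rw [Module.End.mem_eigenspace_iff, toLin'_apply] at hv
  set φ := FiniteField.frobeniusAlgHom F K
  refine Module.End.hasEigenvalue_of_hasEigenvector (x := φ ∘ v)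
    ⟨Module.End.mem_eigenspace_iff.mpr ?_, ?_⟩
  · ext i
    have h := congrArg φ (congrFun hv i)
    simp only [mulVec, dotProduct, map_apply, map_sum, map_mul, AlgHom.commutes, Pi.smul_apply,
      smul_eq_mul] at h
    simpa [mulVec, dotProduct, φ] using h
  · intro h0
    apply hv0
    ext i
    have := congrFun h0 i
    simpa [φ] using this

theorem SymplecticGroup.hasEigenvalue_inv {l K : Type*} [Fintype l] [DecidableEq l] [Field K]
    {M : Matrix (l ⊕ l) (l ⊕ l) K} (hM : M ∈ symplecticGroup l K) {ζ : K}
    (h : Module.End.HasEigenvalue (toLin' M) ζ) : Module.End.HasEigenvalue (toLin' M) ζ⁻¹ := by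
  suffices Module.End.HasEigenvalue (toLin' Mᵀ) ζ⁻¹ by
    rw [Module.End.hasEigenvalue_iff_isRoot_charpoly, Matrix.charpoly_toLin'] at this ⊢
    rwa [Matrix.charpoly_transpose] at this
  obtain ⟨v, hv, hv0⟩ := h.exists_hasEigenvector
  rw [Module.End.mem_eigenspace_iff, toLin'_apply] at hv
  have hJ : Mᵀ *ᵥ (J l K *ᵥ (ζ • v)) = J l K *ᵥ v := by
    rw [← hv, mulVec_mulVec, mulVec_mulVec, SymplecticGroup.mem_iff'.mp hM]
  have hJ0 : J l K *ᵥ v ≠ 0 := by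
    intro h0
    apply hv0
    have := congrArg (fun w => (-J l K) *ᵥ w) h0
    simpa [mulVec_mulVec, J_squared] using this
  have hζ : ζ ≠ 0 := by
    rintro rfl
    exact hJ0 (by simpa using hJ.symm)
  refine Module.End.hasEigenvalue_of_hasEigenvector (x := J l K *ᵥ v)
    ⟨Module.End.mem_eigenspace_iff.mpr ?_, hJ0⟩
  rw [toLin'_apply, eq_inv_smul_iff₀ hζ, ← mulVec_smul, ← mulVec_smul, hJ]

open scoped Pointwise in
theorem SymplecticGroup.lcm_mul_le_of_not_isMulCommutative {l F : Type*} [Fintype l]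
    [DecidableEq l] [Field F] [Fintype F] {r : ℕ} [hr : Fact r.Prime] (hodd : Odd r)
    (hnd : ¬ r ∣ Fintype.card F) {P : Subgroup (symplecticGroup l F)} (hP : IsPGroup r P)
    (hcomm : ¬ IsMulCommutative P) :
    Nat.lcm 2 (orderOf (Fintype.card F : ZMod r)) * r ≤ Fintype.card (l ⊕ l) := by
  classical
  have : Finite (symplecticGroup l F) := inferInstance
  obtain ⟨z, hzc, hzcomm, hzr⟩ := hP.exists_mem_center_mem_commutator_orderOf_eq hcomm
  let K := AlgebraicClosure F
  let ρ : P →* Module.End K (l ⊕ l → K) :=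
    ((Matrix.toLinAlgEquiv' (R := K) (n := l ⊕ l)).toRingEquiv.toMonoidHom.comp
      ((algebraMap F K).mapMatrix : Matrix (l ⊕ l) (l ⊕ l) F →+* _).toMonoidHom).comp
      ((symplecticGroup l F).subtype.comp P.subtype)
  let M : Matrix (l ⊕ l) (l ⊕ l) F := (z : symplecticGroup l F)
  have hρ : ρ z = toLin' (M.map (algebraMap F K)) := rfl
  have hinj : Function.Injective ρ := by
    intro a b hab
    have := (Matrix.toLinAlgEquiv' (R := K) (n := l ⊕ l)).injective hab
    exact Subtype.ext (Subtype.ext (Matrix.map_injective (algebraMap F K).injective this))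
  have hrK : (r : K) ≠ 0 := by
    intro h0
    have hF : (r : F) = 0 := (algebraMap F K).injective (by simpa using h0)
    obtain ⟨p, hp⟩ := CharP.exists F
    have hdvd := (CharP.cast_eq_zero_iff F p r).mp hF
    have hpp : p.Prime := CharP.char_is_prime F p
    rw [Nat.prime_dvd_prime_iff_eq hpp hr.out] at hdvd
    subst hdvd
    exact hnd ((CharP.cast_eq_zero_iff F p _).mp (by simp))
  obtain ⟨ζ, hζ, hζr, hζ1⟩ := Module.End.exists_hasEigenvalue_ne_one hr.out.one_lt hrK
    (f := ρ z) (by rw [← map_pow, ← hzr, pow_orderOf_eq_one, map_one])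
    (fun h => hr.out.one_lt.ne (by rw [← hzr, hinj (h.trans (map_one ρ).symm), orderOf_one]))
  have hord : orderOf ζ = r := orderOf_eq_prime hζr hζ1
  let T : Set (ZMod r)ˣ := {u | (ρ z).HasEigenvalue (ζ ^ (u : ZMod r).val)}
  have hpow (a b : ℕ) (h : (a : ZMod r) = b) : ζ ^ a = ζ ^ b := by
    rw [← pow_mod_orderOf, hord, (ZMod.natCast_eq_natCast_iff' a b r).mp h, ← hord,
      pow_mod_orderOf]
  let u : (ZMod r)ˣ := ZMod.unitOfCoprime (Fintype.card F)
    ((Nat.Prime.coprime_iff_not_dvd hr.out).mpr hnd).symm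
  have hu : u ∈ MulAction.stabilizer (ZMod r)ˣ T := by
    rw [MulAction.mem_stabilizer_set_iff_smul_set_subset T.toFinite]
    rintro _ ⟨w, hw, rfl⟩
    have h := M.hasEigenvalue_pow_card hw
    rw [← pow_mul] at h
    change (ρ z).HasEigenvalue _
    rwa [hpow _ ((w : ZMod r).val * Fintype.card F) (by simp [u, mul_comm])]
  have hneg : -1 ∈ MulAction.stabilizer (ZMod r)ˣ T := by
    rw [MulAction.mem_stabilizer_set_iff_smul_set_subset T.toFinite]
    rintro _ ⟨w, hw, rfl⟩
    have h := SymplecticGroup.hasEigenvalue_inv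
      (SymplecticGroup.map_mem (z : symplecticGroup l F).2 (algebraMap F K)) hw
    have hinv : ζ ^ (((-1 : (ZMod r)ˣ) • w : (ZMod r)ˣ) : ZMod r).val =
        (ζ ^ (w : ZMod r).val)⁻¹ := by
      rw [eq_comm, inv_eq_iff_eq_inv, eq_comm, inv_eq_of_mul_eq_one_left]
      rw [← pow_add, ← pow_zero ζ]
      exact hpow _ _ (by simp)
    change (ρ z).HasEigenvalue _
    rw [hinv]
    exact h
  have hone : (1 : (ZMod r)ˣ) ∈ T := by
    change (ρ z).HasEigenvalue _
    rwa [hpow _ 1 (by simp), pow_one]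
  have hsub : (MulAction.stabilizer (ZMod r)ˣ T : Set (ZMod r)ˣ) ⊆ T := by
    intro w hw
    have := (MulAction.mem_stabilizer_set.mp hw 1).mpr hone
    simpa using this
  have hdvd : Nat.lcm 2 (orderOf (Fintype.card F : ZMod r)) ∣
      Nat.card (MulAction.stabilizer (ZMod r)ˣ T) := by
    refine Nat.lcm_dvd ?_ ?_
    · have := Subgroup.orderOf_dvd_natCard _ hneg
      rwa [← orderOf_units, Units.val_neg, Units.val_one, orderOf_neg_one, ringChar.eq (ZMod r) r,
        if_neg] at this
      rintro rfl
      exact absurd hodd (by decide)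
    · have := Subgroup.orderOf_dvd_natCard _ hu
      rwa [← orderOf_units, ZMod.coe_unitOfCoprime] at this
  let e : (ZMod r)ˣ → K := fun w => ζ ^ (w : ZMod r).val
  have he : Function.Injective e := by
    intro a b hab
    apply Units.ext
    apply ZMod.val_injective r
    exact pow_injOn_Iio_orderOf (by simpa [hord] using ZMod.val_lt _)
      (by simpa [hord] using ZMod.val_lt _) hab
  have hdim (w) (hw : w ∈ T) : r ≤ Module.finrank K ((ρ z).eigenspace (e w)) := by
    have h1 := pow_finrank_eigenspace_eq_one ρ hzc hzcomm (e w)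
    have hew : orderOf (e w) = r := by
      refine orderOf_eq_prime ?_ ?_
      · rw [← pow_mul, mul_comm, pow_mul, hζr, one_pow]
      · intro h
        have h2 := orderOf_dvd_of_pow_eq_one h
        rw [hord, ← CharP.cast_eq_zero_iff (ZMod r) r, ZMod.natCast_val, ZMod.cast_id] at h2
        exact w.ne_zero h2
    refine Nat.le_of_dvd ?_ (hew ▸ orderOf_dvd_of_pow_eq_one h1)
    exact Module.finrank_pos_iff.mpr (Submodule.nontrivial_iff_ne_bot.mpr hw)
  calc Nat.lcm 2 (orderOf (Fintype.card F : ZMod r)) * r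
      ≤ T.toFinset.card * r := by
        refine Nat.mul_le_mul_right r ((Nat.le_of_dvd Nat.card_pos hdvd).trans ?_)
        rw [← Set.ncard_eq_toFinset_card']
        exact Set.ncard_le_ncard hsub
    _ ≤ ∑ w ∈ T.toFinset, Module.finrank K ((ρ z).eigenspace (e w)) := by
        rw [← smul_eq_mul]
        exact Finset.card_nsmul_le_sum _ _ _ fun w hw => hdim w (Set.mem_toFinset.mp hw)
    _ = ∑ ξ ∈ T.toFinset.map ⟨e, he⟩, Module.finrank K ((ρ z).eigenspace ξ) := by simp
    _ ≤ Module.finrank K (l ⊕ l → K) := Module.End.sum_finrank_eigenspace_le _ _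
    _ = Fintype.card (l ⊕ l) := Module.finrank_fintype_fun_eq_card K

namespace SymplecticGroup

variable {l R : Type*} [Fintype l] [DecidableEq l] [CommRing R]

/-- Reindexing of symplectic matrices along an equivalence. -/
def reindexHom {l' : Type*} [Fintype l'] [DecidableEq l'] (e : l' ≃ l) :
    symplecticGroup l R →* symplecticGroup l' R where
  toFun A := ⟨A.1.submatrix (Equiv.sumCongr e e) (Equiv.sumCongr e e), by
    have hJ : J l' R = (J l R).submatrix (Equiv.sumCongr e e) (Equiv.sumCongr e e) := by
      ext (i | i) (j | j) <;> simp [J, Matrix.one_apply]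
    rw [mem_iff, hJ, transpose_submatrix, submatrix_mul_equiv, submatrix_mul_equiv,
      mem_iff.mp A.2]⟩
  map_one' := Subtype.ext (submatrix_one_equiv _)
  map_mul' A B := Subtype.ext (submatrix_mul_equiv _ _ _ _ _).symm

theorem reindexHom_injective {l' : Type*} [Fintype l'] [DecidableEq l']
    (e : l' ≃ l) : Function.Injective (reindexHom (R := R) e) := by
  intro A B h
  apply Subtype.ext
  exact (Matrix.reindex (Equiv.sumCongr e e).symm (Equiv.sumCongr e e).symm).injective
    (congrArg Subtype.val h)

/-- Extension of a symplectic matrix by the identity on an additional summand. -/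
def extendHom (l' : Type*) [Fintype l'] [DecidableEq l'] :
    symplecticGroup l R →* symplecticGroup (l ⊕ l') R where
  toFun A := ⟨(fromBlocks A.1 0 0 1).submatrix (Equiv.sumSumSumComm l l' l l')
      (Equiv.sumSumSumComm l l' l l'), by
    have hJ : J (l ⊕ l') R = (fromBlocks (J l R) 0 0 (J l' R)).submatrix
        (Equiv.sumSumSumComm l l' l l') (Equiv.sumSumSumComm l l' l l') := by
      ext ((i | i) | (i | i)) ((j | j) | (j | j)) <;> simp [J, Matrix.one_apply]
    rw [mem_iff, hJ, transpose_submatrix, submatrix_mul_equiv, submatrix_mul_equiv,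
      fromBlocks_transpose, fromBlocks_multiply, fromBlocks_multiply]
    simp [mem_iff.mp A.2]⟩
  map_one' := by
    ext1
    simp
  map_mul' A B := by
    ext1
    simp [fromBlocks_multiply]

theorem extendHom_injective (l' : Type*) [Fintype l'] [DecidableEq l'] :
    Function.Injective (extendHom (l := l) (R := R) l') := by
  intro A B h
  have := (Matrix.reindex (Equiv.sumSumSumComm l l' l l').symm
    (Equiv.sumSumSumComm l l' l l').symm).injective (congrArg Subtype.val h)
  exact Subtype.ext (fromBlocks_inj.mp this).1

section Wreath

variable {D Q : Type*} [Group Q] [DecidableEq Q]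

/-- The block monomial matrix attached to an element of a regular wreath product. -/
def wreathMatrix {ι : Type*} (φ : D → Matrix ι ι R) (g : D ≀ᵣ Q) : Matrix (ι × Q) (ι × Q) R :=
  of fun s t => if g.right⁻¹ * s.2 = t.2 then φ (g.left s.2) s.1 t.1 else 0

theorem wreathMatrix_mul_blockDiagonal_mul_transpose {ι : Type*} [Fintype ι] [Fintype Q]
    (φ : D → Matrix ι ι R) (B : Matrix ι ι R) (g : D ≀ᵣ Q) :
    wreathMatrix φ g * (blockDiagonal fun _ => B) * (wreathMatrix φ g)ᵀ =
      blockDiagonal fun i => φ (g.left i) * B * (φ (g.left i))ᵀ := by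
  ext ⟨a, i⟩ ⟨b, j⟩
  simp only [wreathMatrix, mul_apply, Fintype.sum_prod_type, blockDiagonal_apply, of_apply,
    transpose_apply, ite_mul, zero_mul, mul_ite, mul_zero, Finset.sum_ite_eq, Finset.mem_univ,
    if_true]
  by_cases h : i = j
  · subst h
    simp
  · simp [h]

variable [Group D]

theorem wreathMatrix_one {ι : Type*} [Fintype ι] [DecidableEq ι] (φ : D →* Matrix ι ι R) :
    wreathMatrix φ (1 : D ≀ᵣ Q) = 1 := by
  ext ⟨a, i⟩ ⟨b, j⟩
  simp [wreathMatrix, Matrix.one_apply, Prod.ext_iff, and_comm, ite_and]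

variable [Fintype Q]

theorem wreathMatrix_mul {ι : Type*} [Fintype ι] [DecidableEq ι] (φ : D →* Matrix ι ι R)
    (g h : D ≀ᵣ Q) : wreathMatrix φ (g * h) = wreathMatrix φ g * wreathMatrix φ h := by
  ext ⟨a, i⟩ ⟨b, j⟩
  simp only [wreathMatrix, of_apply, RegularWreathProduct.mul_left,
    RegularWreathProduct.mul_right, Pi.mul_apply, map_mul]
  simp only [mul_apply, Fintype.sum_prod_type, of_apply, ite_mul, zero_mul, Finset.sum_ite_eq,
    Finset.mem_univ, if_true, _root_.mul_inv_rev, mul_assoc]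
  split_ifs <;> simp

/-- The action of a regular wreath product `D ≀ᵣ Q` by block monomial symplectic matrices
attached to a symplectic representation of `D`. -/
def wreathHom (φ : D →* symplecticGroup l R) : D ≀ᵣ Q →* symplecticGroup (l × Q) R where
  toFun g := ⟨(wreathMatrix ((symplecticGroup l R).subtype.comp φ) g).submatrix
      (Equiv.sumProdDistrib l l Q).symm (Equiv.sumProdDistrib l l Q).symm, by
    have hJ : J (l × Q) R = (blockDiagonal fun _ : Q => J l R).submatrix
        (Equiv.sumProdDistrib l l Q).symm (Equiv.sumProdDistrib l l Q).symm := by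
      ext (⟨i, k⟩ | ⟨i, k⟩) (⟨j, k'⟩ | ⟨j, k'⟩) <;>
        by_cases hk : k = k' <;> simp [J, blockDiagonal_apply, Matrix.one_apply, hk]
    rw [mem_iff, hJ, transpose_submatrix, submatrix_mul_equiv, submatrix_mul_equiv,
      wreathMatrix_mul_blockDiagonal_mul_transpose]
    congr 2
    ext1 i
    exact mem_iff.mp (φ (g.left i)).2⟩
  map_one' := by
    ext1
    simp only [wreathMatrix_one, submatrix_one_equiv, Submonoid.coe_one]
  map_mul' g h := by
    ext1
    simp only [wreathMatrix_mul, submatrix_mul_equiv, Submonoid.coe_mul]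

theorem left_eq_of_wreathHom_eq {φ : D →* symplecticGroup l R} (hφ : Function.Injective φ)
    {g h : D ≀ᵣ Q} (hgh : wreathHom φ g = wreathHom φ h) (hright : g.right = h.right) :
    g.left = h.left := by
  have hM : wreathMatrix ((symplecticGroup l R).subtype.comp φ) g =
      wreathMatrix ((symplecticGroup l R).subtype.comp φ) h :=
    (Matrix.reindex (Equiv.sumProdDistrib l l Q) (Equiv.sumProdDistrib l l Q)).injective
      (congrArg Subtype.val hgh)
  ext i
  apply hφ
  ext a b
  have := congrFun (congrFun hM (a, i)) (b, g.right⁻¹ * i)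
  simpa [wreathMatrix, hright] using this

end Wreath

variable {F : Type*} [Field F]

theorem dotProduct_J_mulVec_self (v : l ⊕ l → R) : v ⬝ᵥ (J l R *ᵥ v) = 0 := by
  simp [J, fromBlocks_mulVec, dotProduct, neg_mulVec, mul_comm]

theorem transvection_mem (a : R) (v : l ⊕ l → R) :
    1 + a • vecMulVec v (J l R *ᵥ v) ∈ symplecticGroup l R := by
  rw [mem_iff']
  have h1 : v ᵥ* J l R = - (J l R *ᵥ v) := by
    rw [← mulVec_transpose, J_transpose, neg_mulVec]
  simp only [transpose_add, transpose_one, transpose_smul, transpose_vecMulVec, add_mul, mul_add,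
    one_mul, mul_one, Matrix.smul_mul, Matrix.mul_smul, vecMulVec_mul _ _ (J l R), mul_vecMulVec (J l R), h1]
  have h2 : vecMulVec (J l R *ᵥ v) (J l R *ᵥ v) * vecMulVec v (J l R *ᵥ v) = 0 := by
    rw [vecMulVec_mul_vecMulVec, dotProduct_comm, dotProduct_J_mulVec_self]
    simp
  simp [h2, vecMulVec_neg]

theorem mem_orbit_of_dotProduct_ne_zero {u w : l ⊕ l → F} (h : (J l F *ᵥ w) ⬝ᵥ u ≠ 0) :
    w ∈ MulAction.orbit (symplecticGroup l F) u := by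
  refine ⟨⟨_, transvection_mem ((J l F *ᵥ w) ⬝ᵥ u)⁻¹ (w - u)⟩, ?_⟩
  change (1 + _ • vecMulVec (w - u) _) *ᵥ u = w
  have hu : (J l F *ᵥ (w - u)) ⬝ᵥ u = (J l F *ᵥ w) ⬝ᵥ u := by
    rw [mulVec_sub, sub_dotProduct, dotProduct_comm (J l F *ᵥ u), dotProduct_J_mulVec_self,
      sub_zero]
  rw [add_mulVec, one_mulVec, smul_mulVec, vecMulVec_mulVec, hu]
  ext i
  simp [h]

theorem mem_orbit_of_ne_zero {u w : l ⊕ l → F} (hu : u ≠ 0) (hw : w ≠ 0) :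
    w ∈ MulAction.orbit (symplecticGroup l F) u := by
  have hJ (x y : l ⊕ l → F) : (J l F *ᵥ x) ⬝ᵥ y = -((J l F *ᵥ y) ⬝ᵥ x) := by
    rw [dotProduct_comm, dotProduct_mulVec, ← mulVec_transpose, J_transpose, neg_mulVec,
      neg_dotProduct]
  have hex {x : l ⊕ l → F} (hx : x ≠ 0) : ∃ y, (J l F *ᵥ x) ⬝ᵥ y ≠ 0 := by
    by_contra! h
    apply hx
    have h0 : J l F *ᵥ x = 0 := dotProduct_eq_zero_iff.mp h
    have := congrArg (fun w => (-J l F) *ᵥ w) h0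
    simpa [mulVec_mulVec, J_squared] using this
  obtain ⟨v, hv1, hv2⟩ : ∃ v, (J l F *ᵥ u) ⬝ᵥ v ≠ 0 ∧ (J l F *ᵥ w) ⬝ᵥ v ≠ 0 := by
    obtain ⟨x, hx⟩ := hex hu
    obtain ⟨y, hy⟩ := hex hw
    by_cases hx' : (J l F *ᵥ w) ⬝ᵥ x = 0
    · by_cases hy' : (J l F *ᵥ u) ⬝ᵥ y = 0
      · exact ⟨x + y, by simpa [dotProduct_add, hy'] using hx,
          by simpa [dotProduct_add, hx'] using hy⟩
      · exact ⟨y, hy', hy⟩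
    · exact ⟨x, hx, hx'⟩
  rw [hJ, neg_ne_zero] at hv1
  have h1 := mem_orbit_of_dotProduct_ne_zero hv1
  rw [← MulAction.orbit_eq_iff.mpr h1]
  exact mem_orbit_of_dotProduct_ne_zero hv2

theorem card_pow_sub_one_dvd_card [Fintype F] [Nonempty l] :
    Fintype.card F ^ Fintype.card (l ⊕ l) - 1 ∣ Nat.card (symplecticGroup l F) := by
  classical
  let u : l ⊕ l → F := 1
  have hu : u ≠ 0 := one_ne_zero
  have horb : MulAction.orbit (symplecticGroup l F) u = {0}ᶜ := by
    ext w
    refine ⟨?_, fun hw => mem_orbit_of_ne_zero hu hw⟩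
    rintro ⟨g, rfl⟩ h
    apply hu
    have h' : g • u = g • (0 : l ⊕ l → F) := by simpa using h
    exact MulAction.injective g h'
  have hcard := Nat.card_congr
    (MulAction.orbitProdStabilizerEquivGroup (symplecticGroup l F) u)
  rw [Nat.card_prod, horb] at hcard
  have horb_card : Nat.card ({0}ᶜ : Set (l ⊕ l → F)) =
      Fintype.card F ^ Fintype.card (l ⊕ l) - 1 := by
    rw [Nat.card_eq_fintype_card, Fintype.card_compl_set]
    simp
  exact Dvd.intro _ (horb_card ▸ hcard)

theorem exists_orderOf_eq [Fintype F] [Nonempty l] {r : ℕ} [Fact r.Prime]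
    (h : orderOf (Fintype.card F : ZMod r) ∣ Fintype.card (l ⊕ l)) :
    ∃ x : symplecticGroup l F, orderOf x = r := by
  refine exists_prime_orderOf_dvd_card' r (dvd_trans ?_ card_pow_sub_one_dvd_card)
  rw [← CharP.cast_eq_zero_iff (ZMod r) r,
    Nat.cast_sub (Nat.one_le_pow _ _ Fintype.card_pos), Nat.cast_pow,
    orderOf_dvd_iff_pow_eq_one.mp h, Nat.cast_one, sub_self]

theorem exists_sylow_not_isMulCommutative {n k r : ℕ} [Fact r.Prime]
    {x : symplecticGroup (Fin k) R} (hx : orderOf x = r) (hn : k * r ≤ n) :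
    ∃ P : Sylow r (symplecticGroup (Fin n) R), ¬ IsMulCommutative P := by
  classical
  have hr : r.Prime := Fact.out
  let Q := Multiplicative (ZMod r)
  let e : Fin n ≃ (Fin k × Q) ⊕ Fin (n - k * r) := Fintype.equivOfCardEq (by
    simp [Q, ZMod.card]; omega)
  let Ψ : Subgroup.zpowers x ≀ᵣ Q →* symplecticGroup (Fin n) R :=
    (reindexHom e).comp ((extendHom _).comp (wreathHom (Subgroup.zpowers x).subtype))
  have hp : IsPGroup r (Subgroup.zpowers x ≀ᵣ Q) := by
    refine IsPGroup.of_card (n := r + 1) ?_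
    rw [RegularWreathProduct.card, Nat.card_zpowers, hx]
    simp [Q, pow_succ]
  obtain ⟨P, hP⟩ := (hp.of_surjective _ Ψ.rangeRestrict_surjective).exists_le_sylow
  refine ⟨P, fun hcomm => ?_⟩
  let X : Subgroup.zpowers x := ⟨x, Subgroup.mem_zpowers x⟩
  let a : Subgroup.zpowers x ≀ᵣ Q := ⟨Pi.mulSingle 1 X, 1⟩
  let b : Subgroup.zpowers x ≀ᵣ Q := ⟨1, Multiplicative.ofAdd 1⟩
  have hΨ : Ψ (a * b) = Ψ (b * a) := by
    rw [map_mul, map_mul]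
    exact setLike_mul_comm (hP ⟨a, rfl⟩) (hP ⟨b, rfl⟩)
  have hleft := left_eq_of_wreathHom_eq (Subgroup.subtype_injective _)
    (extendHom_injective _ (reindexHom_injective _ hΨ)) (by simp [a, b])
  have h1 := congrFun hleft 1
  have hne : (Multiplicative.ofAdd (1 : ZMod r))⁻¹ ≠ 1 := by
    rw [inv_ne_one, ← ofAdd_zero]
    exact fun h => one_ne_zero (Multiplicative.ofAdd.injective h)
  simp [a, b, Pi.mulSingle_eq_of_ne hne] at h1
  have hx1 : x = 1 := congrArg Subtype.val h1
  rw [hx1, orderOf_one] at hx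
  exact hr.one_lt.ne hx

end SymplecticGroup

theorem Nat.lcm_two_mul_of_odd {r : ℕ} (hr : Odd r) (m : ℕ) :
    Nat.lcm 2 (m * r) = Nat.lcm 2 m * r := by
  apply Nat.dvd_antisymm
  · exact Nat.lcm_dvd ((Nat.dvd_lcm_left 2 m).mul_right r)
      (Nat.mul_dvd_mul_right (Nat.dvd_lcm_right 2 m) r)
  · rw [← Nat.lcm_mul_right]
    refine Nat.lcm_dvd ?_ (Nat.dvd_lcm_right _ _)
    exact Nat.Coprime.mul_dvd_of_dvd_of_dvd (Nat.coprime_two_left.mpr hr) (Nat.dvd_lcm_left _ _)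
      ((Nat.dvd_mul_left r m).trans (Nat.dvd_lcm_right _ _))

/-- Let `F` be a finite field of cardinality `q`, `r` an odd prime not dividing `q`, and `m`
the multiplicative order of `q` modulo `r`. For `n ≥ 2`, the Sylow `r`-subgroups of the
symplectic group `Sp_{2n}(F)` are abelian if and only if `2n < lcm(2, m·r)`. -/
theorem symplectic_sylow_isCommutative_iff (F : Type*) [Field F] [Fintype F] (q r m n : ℕ)
    (hq : Fintype.card F = q) (hr : r.Prime) (hodd : Odd r) (hnd : ¬ r ∣ q)
    (hm : m = orderOf (q : ZMod r)) (hn : 2 ≤ n) :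
    (∀ P : Sylow r (Matrix.symplecticGroup (Fin n) F),
        IsMulCommutative (P : Subgroup (Matrix.symplecticGroup (Fin n) F)))
      ↔ 2 * n < Nat.lcm 2 (m * r) := by
  subst hq hm
  have : Fact r.Prime := ⟨hr⟩
  rw [Nat.lcm_two_mul_of_odd hodd]
  constructor
  · contrapose!
    intro hle
    obtain ⟨k, hk⟩ := Nat.dvd_lcm_left 2 (orderOf (Fintype.card F : ZMod r))
    have hm : 0 < orderOf (Fintype.card F : ZMod r) := by
      rw [← ZMod.coe_unitOfCoprime (Fintype.card F)
        ((Nat.Prime.coprime_iff_not_dvd hr).mpr hnd).symm, orderOf_units]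
      exact orderOf_pos _
    have hpos : 0 < k := by
      have := Nat.lcm_pos two_pos hm
      omega
    have : Nonempty (Fin k) := ⟨⟨0, hpos⟩⟩
    obtain ⟨x, hx⟩ := SymplecticGroup.exists_orderOf_eq (l := Fin k) (F := F) (r := r) (by
      rw [Fintype.card_sum, Fintype.card_fin, ← two_mul, ← hk]
      exact Nat.dvd_lcm_right _ _)
    refine SymplecticGroup.exists_sylow_not_isMulCommutative hx ?_
    rw [hk, mul_assoc] at hle
    omega
  · intro hlt P
    by_contra hcomm
    have hle := SymplecticGroup.lcm_mul_le_of_not_isMulCommutative hodd hnd P.isPGroup' hcomm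
    rw [Fintype.card_sum, Fintype.card_fin] at hle
    omega
end
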